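/- arXiv:1303.6933 — 2 statements merged into one kernel-verified Lean document; each statement's English description precedes it below -/
import Mathlib

section
/- Let n ≥ 2, let U ⊆ ℂⁿ be open, and set A = {z ∈ U : z₁ = 0 and z₂ = 0} (the intersection of U with a codimension-two coordinate subspace). Then every function f : ℂⁿ → ℂ analytic on U ∖ A extends to a function g : ℂⁿ → ℂ analytic on U with g = f on U ∖ A; no boundedness hypothesis on f is needed. -/
open Set Filter Topology MeasureTheory
open scoped NNReal ENNReal

theorem param_local {H : Type*} [NormedAddCommGroup H] [NormedSpace ℂ H] {G : H → ℂ} {x0 : H}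
    (hG : AnalyticAt ℂ G x0) : ∃ δ : ℝ, 0 < δ ∧ ∀ (ν : Measure ℝ) [IsFiniteMeasure ν] (γ : ℝ → H),
      Continuous γ → (∀ᵐ θ ∂ν, ‖γ θ - x0‖ < δ) →
      (∀ᶠ h in 𝓝 (0 : H), Integrable (fun θ => G (γ θ + h)) ν) ∧
        AnalyticAt ℂ (fun h => ∫ θ, G (γ θ + h) ∂ν) 0 := by
  obtain ⟨p, R, hp⟩ := hG
  obtain ⟨s, hs0, hsR⟩ := ENNReal.lt_iff_exists_nnreal_btwn.1 hp.r_pos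
  have hs0' : 0 < s := by exact_mod_cast hs0
  obtain ⟨r, hr0, hrs⟩ : ∃ r : ℝ≥0, 0 < r ∧ r + r = s := ⟨s / 2, by positivity, by simp⟩
  have hrR : (r + r : ℝ≥0∞) < R := by rw [← hrs] at hsR; exact_mod_cast hsR
  have hrp : (r + r : ℝ≥0∞) < p.radius := hrR.trans_le hp.r_le
  have hrp1 : (r : ℝ≥0∞) < p.radius := (le_add_right le_rfl).trans_lt hrp
  have hsum := p.changeOriginSeries_summable_aux₁ hrp
  set b : ℕ → ℝ≥0 := fun k =>
    ∑' s : Σ l : ℕ, { s : Finset (Fin (k + l)) // s.card = l }, ‖p (k + s.1)‖₊ * r ^ s.1 with hb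
  have hbsum : Summable fun k => b k * r ^ k := by
    simpa only [hb, ← NNReal.tsum_mul_right] using (NNReal.summable_sigma.1 hsum).2
  have hbound : ∀ (k : ℕ) (y : H), ‖y‖₊ < r → ‖p.changeOrigin y k‖₊ ≤ b k := by
    intro k y hy
    have hy' : (‖y‖₊ : ℝ≥0∞) < p.radius := lt_trans (by exact_mod_cast hy) hrp1
    refine (p.nnnorm_changeOrigin_le k hy').trans ?_
    refine Summable.tsum_le_tsum (fun i => ?_) (p.changeOriginSeries_summable_aux₂ hy' k)
      (p.changeOriginSeries_summable_aux₂ hrp1 k)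
    gcongr
  have hhas : ∀ y h : H, ‖y‖₊ < r → ‖h‖₊ < r →
      HasSum (fun n => p.changeOrigin y n fun _ => h) (G (x0 + y + h)) := by
    intro y h hy hh
    have hy' : (‖y‖₊ : ℝ≥0∞) < R := lt_trans (by exact_mod_cast hy) ((le_add_right le_rfl).trans_lt hrR)
    refine (hp.changeOrigin hy').hasSum ?_
    rw [Metric.mem_eball, edist_zero_right, enorm_eq_nnnorm, lt_tsub_iff_right]
    refine lt_trans ?_ hrR
    exact_mod_cast add_lt_add hh hy
  have hcont : ∀ k, ContinuousOn (fun y => p.changeOrigin y k) (Metric.ball 0 (r : ℝ)) := by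
    intro k
    refine (p.hasFPowerSeriesOnBall_changeOrigin k (hp.r_pos.trans_le hp.r_le)).continuousOn.mono ?_
    intro y hy
    rw [Metric.mem_eball, edist_zero_right, enorm_eq_nnnorm]
    refine lt_trans ?_ hrp1
    have : ‖y‖ < r := by simpa using hy
    exact_mod_cast this
  refine ⟨r, by exact_mod_cast hr0, ?_⟩
  intro ν _ γ hγ hν
  have hN : IsOpen {θ | ‖γ θ - x0‖ < r} := isOpen_lt (by fun_prop) (by fun_prop)
  have hνN : ν.restrict {θ | ‖γ θ - x0‖ < r} = ν := Measure.restrict_eq_self_of_ae_mem hν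
  have hmeas : ∀ k, AEStronglyMeasurable (fun θ => p.changeOrigin (γ θ - x0) k) ν := by
    intro k
    rw [← hνN]
    refine ContinuousOn.aestronglyMeasurable ?_ hN.measurableSet
    exact (hcont k).comp (by fun_prop) (fun θ hθ => by simpa using hθ)
  have hν' : ∀ᵐ θ ∂ν, ‖γ θ - x0‖₊ < r := by
    filter_upwards [hν] with θ hθ
    exact_mod_cast hθ
  have h_integrable : ∀ k, Integrable (fun θ => p.changeOrigin (γ θ - x0) k) ν := by
    intro k
    refine Integrable.of_bound (hmeas k) (b k) ?_
    filter_upwards [hν'] with θ hθ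
    exact_mod_cast hbound k _ hθ
  have hmeas' : ∀ k (h : H), AEStronglyMeasurable (fun θ => p.changeOrigin (γ θ - x0) k fun _ => h) ν := by
    intro k h
    exact ((ContinuousMultilinearMap.apply ℂ (fun _ : Fin k => H) ℂ (fun _ => h)).continuous).comp_aestronglyMeasurable (hmeas k)
  have hb' : ∀ h : H, ‖h‖₊ < r → ∀ k, ∀ᵐ θ ∂ν,
      ‖p.changeOrigin (γ θ - x0) k fun _ => h‖ ≤ ((b k * r ^ k : ℝ≥0) : ℝ) := by
    intro h hh k
    filter_upwards [hν'] with θ hθ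
    have h1 := (p.changeOrigin (γ θ - x0) k).le_opNNNorm (fun _ => h)
    have h2 : ‖p.changeOrigin (γ θ - x0) k fun _ => h‖₊ ≤ b k * r ^ k := by
      refine h1.trans ?_
      simp only [Finset.prod_const, Finset.card_univ, Fintype.card_fin]
      gcongr
      exact hbound k _ hθ
    exact_mod_cast h2
  have hlim : ∀ h : H, ‖h‖₊ < r → ∀ᵐ θ ∂ν,
      HasSum (fun n => p.changeOrigin (γ θ - x0) n fun _ => h) (G (γ θ + h)) := by
    intro h hh
    filter_upwards [hν'] with θ hθ
    simpa using hhas _ h hθ hh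
  have hbsum' : Summable fun k => ((b k * r ^ k : ℝ≥0) : ℝ) := by exact_mod_cast hbsum
  have hball : ∀ᶠ h in 𝓝 (0 : H), ‖h‖₊ < r := by
    filter_upwards [Metric.ball_mem_nhds (0 : H) (show (0 : ℝ) < r by exact_mod_cast hr0)] with h hh
    have : ‖h‖ < r := by simpa using hh
    exact_mod_cast this
  constructor
  · filter_upwards [hball] with h hh
    have hm : AEStronglyMeasurable (fun θ => G (γ θ + h)) ν := by
      refine aestronglyMeasurable_of_tendsto_ae (u := atTop)
        (f := fun (n : ℕ) θ => ∑ k ∈ Finset.range n, p.changeOrigin (γ θ - x0) k fun _ => h) ?_ ?_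
      · intro n
        exact Finset.aestronglyMeasurable_fun_sum _ (fun k _ => hmeas' k h)
      · filter_upwards [hlim h hh] with θ hθ
        exact hθ.tendsto_sum_nat
    refine Integrable.of_bound hm (∑' k, ((b k * r ^ k : ℝ≥0) : ℝ)) ?_
    filter_upwards [hlim h hh, ae_all_iff.2 (hb' h hh)] with θ hθ hθ'
    rw [← hθ.tsum_eq]
    exact tsum_of_norm_bounded hbsum'.hasSum hθ'
  · let q : FormalMultilinearSeries ℂ H ℂ := fun k => ∫ θ, p.changeOrigin (γ θ - x0) k ∂ν
    refine ⟨q, r, ?_, by exact_mod_cast hr0, ?_⟩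
    · refine q.le_radius_of_summable ?_
      refine Summable.of_nonneg_of_le (fun k => by positivity) (fun k => ?_)
        (hbsum'.mul_right (ν.real univ))
      have : ‖q k‖ ≤ (b k : ℝ) * ν.real univ := by
        refine norm_integral_le_of_norm_le_const ?_
        filter_upwards [hν'] with θ hθ
        exact_mod_cast hbound k _ hθ
      calc ‖q k‖ * (r : ℝ) ^ k ≤ ((b k : ℝ) * ν.real univ) * (r : ℝ) ^ k := by gcongr
        _ = _ := by push_cast; ring
    · intro h hh
      have hh' : ‖h‖₊ < r := by
        rw [Metric.mem_eball, edist_zero_right, enorm_eq_nnnorm] at hh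
        exact_mod_cast hh
      rw [zero_add]
      have := hasSum_integral_of_dominated_convergence (μ := ν)
        (fun k _ => ((b k * r ^ k : ℝ≥0) : ℝ)) (fun k => hmeas' k h) (hb' h hh')
        (Eventually.of_forall fun _ => hbsum') (integrable_const _) (hlim h hh')
      refine this.congr_fun ?_
      intro k
      exact (ContinuousLinearMap.integral_comp_comm
        (ContinuousMultilinearMap.apply ℂ (fun _ : Fin k => H) ℂ (fun _ => h)) (h_integrable k)).symm

theorem param_analytic {H : Type*} [NormedAddCommGroup H] [NormedSpace ℂ H] {G : H → ℂ}
    (μ : Measure ℝ) [IsFiniteMeasure μ] {γ : ℝ → H} (hγ : Continuous γ) {K : Set ℝ}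
    (hK : IsCompact K) (hG : ∀ θ ∈ K, AnalyticAt ℂ G (γ θ)) :
    AnalyticAt ℂ (fun h => ∫ θ in K, G (γ θ + h) ∂μ) 0 := by
  have key : ∃ t, K ⊆ t ∧ MeasurableSet t ∧ ∀ S ⊆ t, MeasurableSet S →
      (∀ᶠ h in 𝓝 (0 : H), IntegrableOn (fun θ => G (γ θ + h)) S μ) ∧
        AnalyticAt ℂ (fun h => ∫ θ in S, G (γ θ + h) ∂μ) 0 := by
    refine hK.induction_on (p := fun K => ∃ t, K ⊆ t ∧ MeasurableSet t ∧ ∀ S ⊆ t, MeasurableSet S →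
      (∀ᶠ h in 𝓝 (0 : H), IntegrableOn (fun θ => G (γ θ + h)) S μ) ∧
        AnalyticAt ℂ (fun h => ∫ θ in S, G (γ θ + h) ∂μ) 0) ?_ ?_ ?_ ?_
    · refine ⟨∅, subset_rfl, MeasurableSet.empty, fun S hS _ => ?_⟩
      obtain rfl := subset_empty_iff.1 hS
      simp only [integrableOn_empty, Measure.restrict_empty, integral_zero_measure]
      exact ⟨by simp, analyticAt_const⟩
    · rintro s s' hss ⟨t, ht, h⟩
      exact ⟨t, hss.trans ht, h⟩
    · rintro s1 s2 ⟨t1, hs1, m1, h1⟩ ⟨t2, hs2, m2, h2⟩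
      refine ⟨t1 ∪ t2, union_subset_union hs1 hs2, m1.union m2, fun S hS mS => ?_⟩
      obtain ⟨a1, b1⟩ := h1 (S ∩ t1) inter_subset_right (mS.inter m1)
      obtain ⟨a2, b2⟩ := h2 (S \ t1) (fun x hx => (hS hx.1).resolve_left hx.2) (mS.diff m1)
      constructor
      · filter_upwards [a1, a2] with h i1 i2
        have := i1.union i2
        rwa [inter_union_sdiff] at this
      · refine (b1.add b2).congr ?_
        filter_upwards [a1, a2] with h i1 i2
        have := setIntegral_union (disjoint_sdiff_inter.symm) (mS.diff m1) i1 i2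
        rw [inter_union_sdiff] at this
        exact this.symm
    · intro θ hθ
      obtain ⟨δ, hδ, h⟩ := param_local (hG θ hθ)
      have hN : IsOpen {τ | ‖γ τ - γ θ‖ < δ} := isOpen_lt (by fun_prop) (by fun_prop)
      refine ⟨{τ | ‖γ τ - γ θ‖ < δ}, mem_nhdsWithin_of_mem_nhds (hN.mem_nhds (by simpa using hδ)),
        _, subset_rfl, hN.measurableSet, fun S hS mS => ?_⟩
      exact h (μ.restrict S) γ hγ ((ae_restrict_iff' mS).2 (Eventually.of_forall fun τ hτ => hS hτ))
  obtain ⟨t, hKt, -, h⟩ := key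
  exact (h K hKt hK.measurableSet).2

theorem neBot_coord {n : ℕ} (j : Fin n) (z : Fin n → ℂ) : (𝓝[{y | y j ≠ 0}] z).NeBot := by
  have hd : Dense {y : Fin n → ℂ | y j ≠ 0} :=
    (dense_compl_singleton (0 : ℂ)).preimage (isOpenMap_eval j)
  exact mem_closure_iff_nhdsWithin_neBot.1 (hd z)

theorem local_ext {n : ℕ} {i j : Fin n} (hij : i ≠ j) {U : Set (Fin n → ℂ)} (hU : IsOpen U)
    {f : (Fin n → ℂ) → ℂ} (hf : ∀ z ∈ U, ¬ (z i = 0 ∧ z j = 0) → AnalyticAt ℂ f z)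
    {a : Fin n → ℂ} (ha : a ∈ U) (hai : a i = 0) :
    ∃ g : (Fin n → ℂ) → ℂ, AnalyticAt ℂ g a ∧
      ∀ᶠ z in 𝓝 a, ¬ (z i = 0 ∧ z j = 0) → g z = f z := by
  obtain ⟨ε, hε, hball⟩ := Metric.isOpen_iff.1 hU a ha
  set r := ε / 2 with hr
  have hr0 : 0 < r := by positivity
  have hrε : r < ε := by rw [hr]; linarith
  have hup : ∀ z ∈ Metric.ball a r, ∀ w : ℂ, ‖w‖ ≤ r → Function.update z i w ∈ U := by
    intro z hz w hw
    apply hball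
    rw [Metric.mem_ball, dist_pi_lt_iff hε]
    intro k
    by_cases hk : k = i
    · subst hk
      simp [hai]
      linarith
    · rw [Function.update_of_ne hk]
      exact ((dist_le_pi_dist z a k).trans_lt hz).trans hrε
  let G : ℂ × (Fin n → ℂ) → ℂ := fun x =>
    (x.1 * Complex.I) * ((x.1 - x.2 i)⁻¹ * f (Function.update x.2 i x.1))
  let γ : ℝ → ℂ × (Fin n → ℂ) := fun θ => (circleMap 0 r θ, a)
  have hupd : ∀ x : ℂ × (Fin n → ℂ), AnalyticAt ℂ
      (fun x : ℂ × (Fin n → ℂ) => Function.update x.2 i x.1) x := by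
    intro x
    rw [analyticAt_pi_iff]
    intro k
    by_cases hk : k = i
    · subst hk
      simpa using analyticAt_fst
    · simp only [Function.update_of_ne hk]
      exact ((ContinuousLinearMap.proj (R := ℂ) (φ := fun _ : Fin n => ℂ) k).analyticAt _).comp analyticAt_snd
  have hGan : ∀ θ, AnalyticAt ℂ G (γ θ) := by
    intro θ
    have hn : ‖circleMap 0 r θ‖ = r := by simp [abs_of_pos hr0]
    have hne : circleMap 0 r θ ≠ 0 := by
      intro h; rw [h] at hn; simp at hn; linarith
    have hsnd : AnalyticAt ℂ (fun x : ℂ × (Fin n → ℂ) => x.2 i) (γ θ) :=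
      ((ContinuousLinearMap.proj (R := ℂ) (φ := fun _ : Fin n => ℂ) i).analyticAt _).comp analyticAt_snd
    refine (analyticAt_fst.mul analyticAt_const).mul (((analyticAt_fst.sub hsnd).inv ?_).mul ?_)
    · simpa [γ, hai] using hr0.ne'
    · refine AnalyticAt.comp (g := f) (f := fun x : ℂ × (Fin n → ℂ) => Function.update x.2 i x.1)
        ?_ (hupd _)
      refine hf _ (hup a (Metric.mem_ball_self hr0) _ hn.le) ?_
      rintro ⟨h, -⟩
      simp [γ] at h
      exact hr0.ne' h
  have hγ : Continuous γ := by
    exact (continuous_circleMap 0 r).prodMk continuous_const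
  have hI := param_analytic (volume.restrict (Ioc 0 (2 * Real.pi))) hγ
    (isCompact_Icc (a := (0 : ℝ)) (b := 2 * Real.pi)) (fun θ _ => hGan θ)
  rw [Measure.restrict_restrict measurableSet_Icc,
    inter_eq_self_of_subset_right Ioc_subset_Icc_self] at hI
  let g : (Fin n → ℂ) → ℂ := fun z => (2 * Real.pi * Complex.I : ℂ)⁻¹ *
    ∮ w in C(0, r), (w - z i)⁻¹ • f (Function.update z i w)
  have hgan : AnalyticAt ℂ g a := by
    have h2 : AnalyticAt ℂ (fun z : Fin n → ℂ => ((0 : ℂ), z - a)) a :=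
      analyticAt_const.prod (analyticAt_id.sub analyticAt_const)
    have h3 := AnalyticAt.comp_of_eq hI h2 (by simp)
    refine (analyticAt_const (v := (2 * Real.pi * Complex.I : ℂ)⁻¹)).mul (h3.congr ?_)
    refine Eventually.of_forall fun z => ?_
    simp only [Function.comp, circleIntegral]
    rw [intervalIntegral.integral_of_le (by positivity)]
    refine integral_congr_ae (Eventually.of_forall fun θ => ?_)
    simp [G, γ]
  have h1 : ∀ z ∈ Metric.ball a r, z j ≠ 0 → g z = f z := by
    intro z hz hzj
    have hd : DifferentiableOn ℂ (fun w => f (Function.update z i w)) (Metric.closedBall 0 r) := by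
      intro w hw
      have hw' : ‖w‖ ≤ r := by simpa using hw
      have e1 : AnalyticAt ℂ f (Function.update z i w) := by
        refine hf _ (hup z hz w hw') ?_
        rintro ⟨-, h⟩
        rw [Function.update_of_ne hij.symm] at h
        exact hzj h
      have e2 : AnalyticAt ℂ (fun w : ℂ => Function.update z i w) w :=
        AnalyticAt.comp (g := fun x : ℂ × (Fin n → ℂ) => Function.update x.2 i x.1)
          (f := fun w : ℂ => (w, z)) (hupd _) (analyticAt_id.prod analyticAt_const)
      exact (AnalyticAt.comp (g := f) (f := fun w : ℂ => Function.update z i w) e1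
        e2).differentiableAt.differentiableWithinAt
    have hzi : z i ∈ Metric.ball (0 : ℂ) r := by
      have := (dist_le_pi_dist z a i).trans_lt hz
      rwa [hai] at this
    have hc := hd.circleIntegral_sub_inv_smul hzi
    simp only [g]
    rw [hc, Function.update_eq_self, smul_eq_mul, inv_mul_cancel_left₀]
    exact Complex.two_pi_I_ne_zero
  refine ⟨g, hgan, ?_⟩
  filter_upwards [hgan.eventually_analyticAt, Metric.ball_mem_nhds a hr0] with z hz hzb hzB
  have hfz : ContinuousAt f z :=
    (hf z (hball (Metric.ball_subset_ball hrε.le hzb)) hzB).continuousAt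
  have := neBot_coord j z
  refine tendsto_nhds_unique (f := g) (l := 𝓝[{y | y j ≠ 0}] z)
    (hz.continuousAt.mono_left nhdsWithin_le_nhds) ?_
  refine (hfz.tendsto.mono_left nhdsWithin_le_nhds).congr' ?_
  filter_upwards [self_mem_nhdsWithin,
    mem_nhdsWithin_of_mem_nhds (Metric.isOpen_ball.mem_nhds hzb)] with y hy hyb
  exact (h1 y hyb hy).symm

theorem global_ext {n : ℕ} {i j : Fin n} (hij : i ≠ j) {U : Set (Fin n → ℂ)} (hU : IsOpen U)
    {f : (Fin n → ℂ) → ℂ} (hf : ∀ z ∈ U, ¬ (z i = 0 ∧ z j = 0) → AnalyticAt ℂ f z) :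
    ∃ g : (Fin n → ℂ) → ℂ, (∀ z ∈ U, AnalyticAt ℂ g z) ∧ ∀ z, ¬ (z i = 0 ∧ z j = 0) → g z = f z := by
  classical
  let g : (Fin n → ℂ) → ℂ := fun z =>
    if z i = 0 ∧ z j = 0 then limUnder (𝓝[{y | y j ≠ 0}] z) f else f z
  have hg : ∀ z, ¬ (z i = 0 ∧ z j = 0) → g z = f z := fun z hz => if_neg hz
  refine ⟨g, fun a ha => ?_, hg⟩
  by_cases haB : a i = 0 ∧ a j = 0
  · obtain ⟨g', hg', he⟩ := local_ext hij hU hf ha haB.1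
    refine hg'.congr ?_
    filter_upwards [hg'.eventually_analyticAt, he.eventually_nhds] with z hz hez
    by_cases hzB : z i = 0 ∧ z j = 0
    · have := neBot_coord j z
      have : Tendsto f (𝓝[{y | y j ≠ 0}] z) (𝓝 (g' z)) := by
        refine (hz.continuousAt.tendsto.mono_left nhdsWithin_le_nhds).congr' ?_
        filter_upwards [self_mem_nhdsWithin, mem_nhdsWithin_of_mem_nhds hez] with y hy hey
        exact hey fun h => hy h.2
      simp only [g, if_pos hzB]
      exact this.limUnder_eq.symm
    · rw [hg z hzB, hez.self_of_nhds hzB]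
  · refine (hf a ha haB).congr ?_
    have hB : IsClosed {z : Fin n → ℂ | z i = 0 ∧ z j = 0} :=
      (isClosed_eq (continuous_apply i) continuous_const).inter
        (isClosed_eq (continuous_apply j) continuous_const)
    filter_upwards [hB.isOpen_compl.mem_nhds haB] with z hz
    exact (hg z hz).symm


/-- **Extension across analytic sets of codimension at least two.** Let `n ≥ 2`,
`U ⊆ ℂⁿ` open, and `A = {z ∈ U : z₁ = 0 ∧ z₂ = 0}`. Then every function holomorphic
on `U \ A` extends holomorphically to `U`; no boundedness hypothesis is needed. -/
theorem extension_across_codim_two {n : ℕ} (hn : 2 ≤ n)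
    {U : Set (Fin n → ℂ)} (hU : IsOpen U)
    (A : Set (Fin n → ℂ))
    (hA : A = {z ∈ U | z ⟨0, by omega⟩ = 0 ∧ z ⟨1, by omega⟩ = 0})
    (f : (Fin n → ℂ) → ℂ) (hf : AnalyticOn ℂ f (U \ A)) :
    ∃ g : (Fin n → ℂ) → ℂ, AnalyticOn ℂ g U ∧ Set.EqOn g f (U \ A) := by
  have hij : (⟨0, by omega⟩ : Fin n) ≠ ⟨1, by omega⟩ := by simp
  have hB : IsClosed {z : Fin n → ℂ | z ⟨0, by omega⟩ = 0 ∧ z ⟨1, by omega⟩ = 0} :=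
    (isClosed_eq (continuous_apply _) continuous_const).inter
      (isClosed_eq (continuous_apply _) continuous_const)
  have hUA : U \ A = U \ {z : Fin n → ℂ | z ⟨0, by omega⟩ = 0 ∧ z ⟨1, by omega⟩ = 0} := by
    subst hA
    ext z
    simp only [Set.mem_sdiff, Set.mem_ofPred_eq]
    tauto
  rw [hUA] at hf ⊢
  have hf' := (hU.sdiff hB).analyticOn_iff_analyticOnNhd.1 hf
  obtain ⟨g, h1, h2⟩ := global_ext hij hU (fun z hz hzB => hf' z ⟨hz, hzB⟩)
  exact ⟨g, fun z hz => (h1 z hz).analyticWithinAt, fun z hz => h2 z hz.2⟩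
end

section
/- Let ι be an index type and let (Uᵢ)_{i ∈ ι} be an open cover of ℂⁿ. Suppose for each pair (i, j) we are given a function f_{ij} : ℂⁿ → ℂ analytic on Uᵢ ∩ Uⱼ such that f_{ij} = −f_{ji} on Uᵢ ∩ Uⱼ and f_{ij} + f_{jk} = f_{ik} on Uᵢ ∩ Uⱼ ∩ U_k for all i, j, k. Then there exist functions gᵢ : ℂⁿ → ℂ, each analytic on Uᵢ, such that f_{ij} = gⱼ − gᵢ on Uᵢ ∩ Uⱼ for all i, j. -/
section CousinHelpers

open Set Filter Topology MeasureTheory Interval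


def CHol {n : ℕ} (f : (Fin n → ℂ) → ℂ) (W : Set (Fin n → ℂ)) : Prop :=
  ∀ z ∈ W, ContinuousAt f z ∧
    ∀ j, DifferentiableAt ℂ (fun w => f (Function.update z j w)) (z j)

namespace CHol
variable {n : ℕ} {f g : (Fin n → ℂ) → ℂ} {W W' : Set (Fin n → ℂ)}

theorem mono (h : CHol f W) (hs : W' ⊆ W) : CHol f W' := fun z hz => h z (hs hz)

theorem union (h : CHol f W) (h' : CHol f W') : CHol f (W ∪ W') := by
  rintro z (hz | hz)
  exacts [h z hz, h' z hz]

theorem add (h : CHol f W) (h' : CHol g W) : CHol (fun z => f z + g z) W :=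
  fun z hz => ⟨(h z hz).1.add (h' z hz).1, fun j => ((h z hz).2 j).add ((h' z hz).2 j)⟩

theorem sub (h : CHol f W) (h' : CHol g W) : CHol (fun z => f z - g z) W :=
  fun z hz => ⟨(h z hz).1.sub (h' z hz).1, fun j => ((h z hz).2 j).sub ((h' z hz).2 j)⟩

theorem neg (h : CHol f W) : CHol (fun z => - f z) W :=
  fun z hz => ⟨(h z hz).1.neg, fun j => ((h z hz).2 j).neg⟩

theorem const_mul (c : ℂ) (h : CHol f W) : CHol (fun z => c * f z) W :=
  fun z hz => ⟨continuousAt_const.mul (h z hz).1, fun j => ((h z hz).2 j).const_mul c⟩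

theorem const (c : ℂ) : CHol (fun _ : Fin n → ℂ => c) W :=
  fun _ _ => ⟨continuousAt_const, fun _ => differentiableAt_const c⟩

theorem sum {κ : Type*} (s : Finset κ) {F : κ → (Fin n → ℂ) → ℂ} (h : ∀ k ∈ s, CHol (F k) W) :
    CHol (fun z => ∑ k ∈ s, F k z) W := by
  classical
  induction s using Finset.induction_on with
  | empty => simpa using const 0
  | insert a s ha ih =>
    simp only [Finset.sum_insert ha]
    exact (h a (Finset.mem_insert_self a s)).add
      (ih fun k hk => h k (Finset.mem_insert_of_mem hk))

theorem tendsto_update (z : Fin n → ℂ) (j : Fin n) :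
    Tendsto (fun w => Function.update z j w) (𝓝 (z j)) (𝓝 z) := by
  have : Continuous (fun w => Function.update z j w) := continuous_const.update j continuous_id
  simpa using this.tendsto (z j)

theorem congr (hW : IsOpen W) (h : CHol f W) (he : ∀ z ∈ W, f z = g z) : CHol g W := by
  intro z hz
  have hev : f =ᶠ[𝓝 z] g := by
    filter_upwards [hW.mem_nhds hz] with y hy using he y hy
  refine ⟨(h z hz).1.congr hev, fun j => ?_⟩
  exact ((h z hz).2 j).congr_of_eventuallyEq ((tendsto_update z j).eventually hev.symm)

theorem of_analyticOn (hW : IsOpen W) (h : AnalyticOn ℂ f W) : CHol f W := by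
  intro z hz
  have hd : DifferentiableAt ℂ f z := (h.differentiableOn z hz).differentiableAt (hW.mem_nhds hz)
  refine ⟨hd.continuousAt, fun j => ?_⟩
  have h2 : DifferentiableAt ℂ f (Function.update z j (z j)) := by simpa using hd
  exact h2.comp (z j) ((hasFDerivAt_update z (z j)).differentiableAt)

theorem continuousOn (h : CHol f W) : ContinuousOn f W :=
  fun z hz => (h z hz).1.continuousWithinAt

theorem slice (h : CHol f W) (z : Fin n → ℂ) (j : Fin n) {V : Set ℂ}
    (hV : ∀ w ∈ V, Function.update z j w ∈ W) :
    DifferentiableOn ℂ (fun w => f (Function.update z j w)) V := by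
  intro w hw
  have := (h _ (hV w hw)).2 j
  simp only [Function.update_idem, Function.update_self] at this
  exact this.differentiableWithinAt

theorem isOpen_slice (hW : IsOpen W) (z : Fin n → ℂ) (j : Fin n) :
    IsOpen {w | Function.update z j w ∈ W} :=
  hW.preimage (continuous_const.update j continuous_id)

end CHol

theorem differentiableOn_param {V : Set ℂ} (hV : IsOpen V) {F : ℂ → ℝ → ℂ} {a b : ℝ}
    (hc : ContinuousOn (Function.uncurry F) (V ×ˢ uIcc a b))
    (hd : ∀ t ∈ uIcc a b, DifferentiableOn ℂ (fun w => F w t) V) :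
    DifferentiableOn ℂ (fun w => ∫ t in a..b, F w t) V := by
  intro w0 hw0
  obtain ⟨ε, hε, hball⟩ := Metric.nhds_basis_closedBall.mem_iff.1 (hV.mem_nhds hw0)
  set r := ε / 2 with hr
  have hr0 : 0 < r := by positivity
  have hcpt : IsCompact (Metric.closedBall w0 ε ×ˢ uIcc a b) :=
    (isCompact_closedBall w0 ε).prod isCompact_uIcc
  obtain ⟨M, hM⟩ := hcpt.exists_bound_of_continuousOn
    (hc.mono (prod_mono hball le_rfl))
  have hslice : ∀ w ∈ V, ContinuousOn (F w) (uIcc a b) := by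
    intro w hw
    exact hc.comp (f := fun t : ℝ => (w, t)) (by fun_prop) (fun t ht => ⟨hw, ht⟩)
  have hmeas : ∀ w ∈ V, AEStronglyMeasurable (F w) (volume.restrict (Ι a b)) := by
    intro w hw
    exact ((hslice w hw).mono uIoc_subset_uIcc).aestronglyMeasurable measurableSet_uIoc
  have hderiv : ∀ t ∈ uIcc a b, ∀ w ∈ V, HasDerivAt (fun w => F w t) (deriv (fun w => F w t) w) w :=
    fun t ht w hw => ((hd t ht w hw).differentiableAt (hV.mem_nhds hw)).hasDerivAt
  have hbV : Metric.ball w0 r ⊆ V := fun w hw => hball (by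
    rw [Metric.mem_ball] at hw; rw [Metric.mem_closedBall]; linarith)
  have key := intervalIntegral.hasDerivAt_integral_of_dominated_loc_of_deriv_le
    (μ := volume) (F := F) (F' := fun w t => deriv (fun w => F w t) w) (x₀ := w0)
    (a := a) (b := b) (bound := fun _ => M / r) (Metric.ball_mem_nhds w0 hr0)
    (by filter_upwards [hV.mem_nhds hw0] with w hw using hmeas w hw)
    ((hslice w0 hw0).intervalIntegrable)
    ?_ ?_ (by simp) ?_
  · exact key.2.differentiableAt.differentiableWithinAt
  · have hseq : Tendsto (fun k : ℕ => w0 + ((1 / ((k : ℝ) + 1) * r : ℝ) : ℂ)) atTop (𝓝[≠] w0) := by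
      refine tendsto_nhdsWithin_iff.2 ⟨?_, ?_⟩
      · have h1 : Tendsto (fun k : ℕ => (1 / ((k : ℝ) + 1) * r : ℝ)) atTop (𝓝 (0 * r)) :=
          tendsto_one_div_add_atTop_nhds_zero_nat.mul_const r
        have h2 := (Complex.continuous_ofReal.tendsto _).comp h1
        have := h2.const_add w0
        simpa [Function.comp_def] using this
      · refine Eventually.of_forall fun k => ?_
        have : (1 / ((k : ℝ) + 1) * r : ℝ) ≠ 0 := by positivity
        simp only [mem_compl_iff, mem_singleton_iff, add_eq_left]
        exact_mod_cast this
    have hin : ∀ k : ℕ, w0 + ((1 / ((k : ℝ) + 1) * r : ℝ) : ℂ) ∈ V := by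
      intro k
      apply hball
      rw [Metric.mem_closedBall, dist_eq_norm, add_sub_cancel_left, Complex.norm_real,
        Real.norm_of_nonneg (by positivity)]
      have : 1 / ((k : ℝ) + 1) ≤ 1 := by
        rw [div_le_one (by positivity)]; linarith [(Nat.cast_nonneg k : (0:ℝ) ≤ k)]
      nlinarith
    refine aestronglyMeasurable_of_tendsto_ae atTop
      (f := fun (k : ℕ) t => slope (fun w => F w t) w0 (w0 + ((1 / ((k : ℝ) + 1) * r : ℝ) : ℂ)))
      (fun k => ?_) ?_
    · simp only [slope_def_field]
      simp only [div_eq_mul_inv]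
      exact ((hmeas _ (hin k)).sub (hmeas _ hw0)).mul_const _
    · refine (ae_restrict_iff' measurableSet_uIoc).2 (Eventually.of_forall fun t ht => ?_)
      exact ((hasDerivAt_iff_tendsto_slope.1 (hderiv t (uIoc_subset_uIcc ht) w0 hw0)).comp hseq)
  · refine Eventually.of_forall fun t ht w hw => ?_
    have hsub : Metric.closedBall w r ⊆ Metric.closedBall w0 ε := by
      apply Metric.closedBall_subset_closedBall'
      rw [Metric.mem_ball] at hw; linarith
    refine Complex.norm_deriv_le_of_forall_mem_sphere_norm_le hr0 ?_ ?_
    · refine DifferentiableOn.diffContOnCl ?_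
      refine (hd t (uIoc_subset_uIcc ht)).mono ?_
      exact (Metric.closure_ball_subset_closedBall.trans hsub).trans hball
    · intro z hz
      exact hM (z, t) ⟨hsub (Metric.sphere_subset_closedBall hz), uIoc_subset_uIcc ht⟩
  · exact Eventually.of_forall fun t ht w hw => hderiv t (uIoc_subset_uIcc ht) w (hbV hw)

theorem CHol.param {n : ℕ} {W : Set (Fin n → ℂ)} (hW : IsOpen W) {F : (Fin n → ℂ) → ℝ → ℂ}
    {a b : ℝ} (hc : ContinuousOn (Function.uncurry F) (W ×ˢ uIcc a b))
    (hd : ∀ t ∈ uIcc a b, CHol (fun w => F w t) W) :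
    CHol (fun w => ∫ t in a..b, F w t) W := by
  intro z0 hz0
  have hslice : ∀ w ∈ W, ContinuousOn (F w) (uIcc a b) := by
    intro w hw
    exact hc.comp (f := fun t : ℝ => (w, t)) (by fun_prop) (fun t ht => ⟨hw, ht⟩)
  have hmeas : ∀ w ∈ W, AEStronglyMeasurable (F w) (volume.restrict (Ι a b)) := by
    intro w hw
    exact ((hslice w hw).mono uIoc_subset_uIcc).aestronglyMeasurable measurableSet_uIoc
  constructor
  · obtain ⟨ε, hε, hball⟩ := Metric.nhds_basis_closedBall.mem_iff.1 (hW.mem_nhds hz0)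
    have hcpt : IsCompact (Metric.closedBall z0 ε ×ˢ uIcc a b) :=
      (isCompact_closedBall z0 ε).prod isCompact_uIcc
    obtain ⟨M, hM⟩ := hcpt.exists_bound_of_continuousOn
      (hc.mono (prod_mono hball le_rfl))
    refine intervalIntegral.continuousAt_of_dominated_interval (bound := fun _ => M) ?_ ?_ (by simp) ?_
    · filter_upwards [hW.mem_nhds hz0] with w hw using hmeas w hw
    · filter_upwards [Metric.closedBall_mem_nhds z0 hε] with w hw
      exact Eventually.of_forall fun t ht => hM (w, t) ⟨hw, uIoc_subset_uIcc ht⟩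
    · exact Eventually.of_forall fun t ht => (hd t (uIoc_subset_uIcc ht) z0 hz0).1
  · intro j
    have hV := CHol.isOpen_slice hW z0 j
    have := differentiableOn_param hV (F := fun w t => F (Function.update z0 j w) t)
      (a := a) (b := b) ?_ ?_
    · exact (this (z0 j) (by simpa using hz0)).differentiableAt (hV.mem_nhds (by simpa using hz0))
    · refine hc.comp (f := fun p : ℂ × ℝ => (Function.update z0 j p.1, p.2)) ?_ ?_
      · have h1 : Continuous (fun p : ℂ × ℝ => Function.update z0 j p.1) :=
          continuous_const.update j continuous_fst
        exact (h1.prodMk continuous_snd).continuousOn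
      · rintro ⟨w, t⟩ ⟨hw, ht⟩
        exact ⟨hw, ht⟩
    · intro t ht
      exact (hd t ht).slice z0 j (fun w hw => hw)


theorem torusMap_mem_closedBall {n : ℕ} (c : Fin n → ℂ) {r : ℝ} (hr : 0 ≤ r) (θ : Fin n → ℝ) :
    torusMap c (fun _ => r) θ ∈ Metric.closedBall c r := by
  rw [Metric.mem_closedBall, dist_pi_le_iff hr]
  intro j
  simp [torusMap, dist_eq_norm, Complex.norm_exp_ofReal_mul_I, abs_of_nonneg hr]

theorem torusMap_sub_ne {n : ℕ} (c : Fin n → ℂ) {r : ℝ} (hr : 0 < r) (θ : Fin n → ℝ)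
    {z : Fin n → ℂ} (hz : z ∈ Metric.ball c r) (j : Fin n) :
    torusMap c (fun _ => r) θ j - z j ≠ 0 := by
  intro h
  rw [Metric.mem_ball, dist_pi_lt_iff hr] at hz
  have h1 := hz j
  rw [← sub_eq_zero.1 h] at h1
  simp [torusMap, dist_eq_norm, Complex.norm_exp_ofReal_mul_I, abs_of_pos hr] at h1

theorem continuous_torusMap {n : ℕ} (c : Fin n → ℂ) (R : Fin n → ℝ) :
    Continuous (torusMap c R) := by
  unfold torusMap
  fun_prop

theorem torus_integrand_continuous {n : ℕ} {f : (Fin n → ℂ) → ℂ} {W : Set (Fin n → ℂ)}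
    (hf : CHol f W) {c : Fin n → ℂ} {r : ℝ} (hr : 0 < r)
    (hb : Metric.closedBall c r ⊆ W) {z : Fin n → ℂ} (hz : z ∈ Metric.ball c r) :
    Continuous (fun θ => (∏ j, (torusMap c (fun _ => r) θ j - z j)⁻¹) *
      f (torusMap c (fun _ => r) θ)) := by
  have hT := continuous_torusMap c (fun _ => r)
  refine Continuous.mul ?_ ?_
  · refine continuous_finsetProd _ fun j _ => ?_
    refine Continuous.inv₀ (((continuous_apply j).comp hT).sub continuous_const) fun θ => ?_
    exact torusMap_sub_ne c hr θ hz j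
  · exact hf.continuousOn.comp_continuous hT fun θ => hb (torusMap_mem_closedBall c hr.le θ)

theorem polydisc_cauchy {n : ℕ} : ∀ {f : (Fin n → ℂ) → ℂ} {W : Set (Fin n → ℂ)} (_ : IsOpen W)
    (_ : CHol f W) {c : Fin n → ℂ} {r : ℝ} (_ : 0 < r)
    (_ : Metric.closedBall c r ⊆ W) {z : Fin n → ℂ} (_ : z ∈ Metric.ball c r),
    torusIntegral (fun ζ => (∏ j, (ζ j - z j)⁻¹) * f ζ) c (fun _ => r)
      = (2 * Real.pi * Complex.I) ^ n * f z := by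
  induction n with
  | zero =>
    intro f W _ _ c r _ _ z _
    rw [torusIntegral_dim0]
    simp [Subsingleton.elim c z]
  | succ n ih =>
    intro f W hW hf c r hr hb z hz
    have hIntg : TorusIntegrable (fun ζ => (∏ j, (ζ j - z j)⁻¹) * f ζ) c (fun _ => r) :=
      (torus_integrand_continuous hf hr hb hz).continuousOn.integrableOn_compact isCompact_Icc
    have hz' := hz
    rw [Metric.mem_ball, dist_pi_lt_iff hr] at hz'
    have hcons : ∀ x ∈ Metric.closedBall (c 0) r, ∀ y ∈ Metric.closedBall (c ∘ Fin.succ) r,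
        (Fin.cons x y : Fin (n + 1) → ℂ) ∈ W := by
      intro x hx y hy
      apply hb
      rw [Metric.mem_closedBall, dist_pi_le_iff hr.le] at *
      intro j
      refine Fin.cases ?_ (fun i => ?_) j
      · simpa using hx
      · simpa using hy i
    have htail : z ∘ Fin.succ ∈ Metric.ball (c ∘ Fin.succ) r := by
      rw [Metric.mem_ball, dist_pi_lt_iff hr]
      exact fun i => hz' i.succ
    rw [torusIntegral_succ hIntg]
    have hinner : ∀ x ∈ Metric.sphere (c 0) r,
        torusIntegral (fun y : Fin n → ℂ => (∏ j, ((Fin.cons x y : Fin (n + 1) → ℂ) j - z j)⁻¹) *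
          f (Fin.cons x y)) (c ∘ Fin.succ) ((fun _ => r) ∘ Fin.succ)
        = (x - z 0)⁻¹ • ((2 * Real.pi * Complex.I) ^ n * f (Function.update z 0 x)) := by
      intro x hx
      have hcont : Continuous (fun y : Fin n → ℂ => (Fin.cons x y : Fin (n + 1) → ℂ)) :=
        continuous_const.finCons continuous_id
      have hO : IsOpen {y : Fin n → ℂ | (Fin.cons x y : Fin (n + 1) → ℂ) ∈ W} := hW.preimage hcont
      have hH : CHol (fun y : Fin n → ℂ => f (Fin.cons x y))
          {y : Fin n → ℂ | (Fin.cons x y : Fin (n + 1) → ℂ) ∈ W} := by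
        intro y hy
        refine ⟨(hf _ hy).1.comp hcont.continuousAt, fun j => ?_⟩
        have := (hf _ hy).2 j.succ
        simpa only [← Fin.cons_update, Fin.cons_succ] using this
      have h := ih hO hH hr (fun y hy => hcons x (Metric.sphere_subset_closedBall hx) y hy) htail
      have e1 : (fun y : Fin n → ℂ => (∏ j, ((Fin.cons x y : Fin (n + 1) → ℂ) j - z j)⁻¹) *
          f (Fin.cons x y)) = fun y => (x - z 0)⁻¹ *
            ((∏ j, (y j - (z ∘ Fin.succ) j)⁻¹) * f (Fin.cons x y)) := by
        funext y
        rw [Fin.prod_univ_succ]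
        simp [mul_assoc]
      rw [e1, torusIntegral_const_mul]
      have e2 : (Fin.cons x (z ∘ Fin.succ) : Fin (n + 1) → ℂ) = Function.update z 0 x := by
        have := Fin.update_cons_zero (α := fun _ => ℂ) (z 0) (z ∘ Fin.succ) x
        rw [← this]
        congr 1
        exact Fin.cons_self_tail z
      rw [← e2, smul_eq_mul]
      congr 1
    have hcongr := circleIntegral.integral_congr hr.le hinner
    refine hcongr.trans ?_
    have hd : DifferentiableOn ℂ (fun x => (2 * Real.pi * Complex.I) ^ n * f (Function.update z 0 x))
        (Metric.closedBall (c 0) r) := by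
      refine DifferentiableOn.const_mul (hf.slice z 0 fun w hw => ?_) _
      apply hb
      rw [Metric.mem_closedBall, dist_pi_le_iff hr.le]
      intro j
      refine Fin.cases ?_ (fun i => ?_) j
      · simpa using hw
      · simpa using (hz' i.succ).le
    rw [hd.circleIntegral_sub_inv_smul (by simpa using hz' 0)]
    simp [pow_succ]
    ring

theorem CHol.analyticAt {n : ℕ} {f : (Fin n → ℂ) → ℂ} {W : Set (Fin n → ℂ)} (hW : IsOpen W)
    (hf : CHol f W) {c : Fin n → ℂ} (hc : c ∈ W) : AnalyticAt ℂ f c := by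
  obtain ⟨r, hr, hb⟩ := Metric.nhds_basis_closedBall.mem_iff.1 (hW.mem_nhds hc)
  let K : Set (Fin n → ℝ) := Icc (0 : Fin n → ℝ) fun _ => 2 * Real.pi
  have : CompactSpace K := isCompact_iff_compactSpace.1 isCompact_Icc
  let μ : Measure K := Measure.comap Subtype.val volume
  have : IsFiniteMeasure μ := by
    constructor
    rw [Measure.comap_apply _ Subtype.val_injective
      (fun s hs => measurableSet_Icc.subtype_image hs) _ MeasurableSet.univ]
    simp only [image_univ, Subtype.range_coe_subtype]
    exact isCompact_Icc.measure_lt_top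
  let T : Fin n → C(K, ℂ) := fun j =>
    ⟨fun θ => torusMap c (fun _ => r) θ.1 j,
      ((continuous_apply j).comp (continuous_torusMap c (fun _ => r))).comp continuous_subtype_val⟩
  let wt : C(K, ℂ) :=
    ⟨fun θ => (∏ i, (r : ℂ) * Complex.exp (θ.1 i * Complex.I) * Complex.I) *
        f (torusMap c (fun _ => r) θ.1), by
      refine Continuous.mul (continuous_finsetProd _ fun i _ => ?_) ?_
      · have h1 : Continuous (fun θ : K => θ.1 i) :=
          (continuous_apply i).comp continuous_subtype_val
        have h2 : Continuous (fun t : ℝ => (r : ℂ) * Complex.exp (t * Complex.I) * Complex.I) := by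
          fun_prop
        exact h2.comp h1
      exact (hf.continuousOn.comp_continuous (continuous_torusMap c (fun _ => r))
        fun θ => hb (torusMap_mem_closedBall c hr.le θ)).comp continuous_subtype_val⟩
  have hIntg : ∀ g : C(K, ℂ), Integrable (fun θ => g θ * wt θ) μ := by
    intro g
    exact (BoundedContinuousFunction.mkOfCompact (g * wt)).integrable μ
  let L0 : C(K, ℂ) →ₗ[ℂ] ℂ :=
    { toFun := fun g => ∫ θ, g θ * wt θ ∂μ
      map_add' := fun g h => by
        rw [← integral_add (hIntg g) (hIntg h)]
        congr 1
        funext θ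
        simp [add_mul]
      map_smul' := fun a g => by
        simp only [ContinuousMap.smul_apply, smul_eq_mul, RingHom.id_apply]
        rw [← integral_const_mul]
        congr 1
        funext θ
        ring }
  let L : C(K, ℂ) →L[ℂ] ℂ := L0.mkContinuous (‖wt‖ * μ.real univ) (by
    intro g
    have := norm_integral_le_of_norm_le_const (μ := μ) (f := fun θ => g θ * wt θ)
      (C := ‖g‖ * ‖wt‖) (Eventually.of_forall fun θ => by
        rw [norm_mul]
        gcongr
        · exact g.norm_coe_le_norm θ
        · exact wt.norm_coe_le_norm θ)
    calc ‖L0 g‖ ≤ ‖g‖ * ‖wt‖ * μ.real univ := this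
      _ = _ := by ring)
  let Φ : (Fin n → ℂ) → C(K, ℂ) := fun z => ∏ j, Ring.inverse (T j - z j • (1 : C(K, ℂ)))
  have hunit : ∀ z ∈ Metric.ball c r, ∀ j, IsUnit (T j - z j • (1 : C(K, ℂ))) := by
    intro z hz j
    rw [ContinuousMap.isUnit_iff_forall_ne_zero]
    intro θ
    simpa [T] using torusMap_sub_ne c hr θ.1 hz j
  have hcball : c ∈ Metric.ball c r := Metric.mem_ball_self hr
  have hΦ : AnalyticAt ℂ Φ c := by
    refine Finset.analyticAt_fun_prod _ fun j _ => ?_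
    have h1 : AnalyticAt ℂ (fun z : Fin n → ℂ => T j - z j • (1 : C(K, ℂ))) c := by
      refine AnalyticAt.fun_sub analyticAt_const (AnalyticAt.fun_smul ?_ analyticAt_const)
      exact (ContinuousLinearMap.proj (R := ℂ) (φ := fun _ : Fin n => ℂ) j).analyticAt c
    obtain ⟨u, hu⟩ := hunit c hcball j
    have h2 := analyticAt_inverse (𝕜 := ℂ) u
    rw [hu] at h2
    exact AnalyticAt.fun_comp (f := fun z : Fin n → ℂ => T j - z j • (1 : C(K, ℂ))) h2 h1
  have hΦval : ∀ z ∈ Metric.ball c r, ∀ θ : K,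
      Φ z θ = ∏ j, (torusMap c (fun _ => r) θ.1 j - z j)⁻¹ := by
    intro z hz θ
    simp only [Φ, ContinuousMap.prod_apply]
    refine Finset.prod_congr rfl fun j _ => ?_
    have h3 := Ring.mul_inverse_cancel _ (hunit z hz j)
    have h4 := DFunLike.congr_fun h3 θ
    have h5 : (torusMap c (fun _ => r) θ.1 j - z j) *
        (Ring.inverse (T j - z j • (1 : C(K, ℂ)))) θ = 1 := by simpa [T] using h4
    exact eq_inv_of_mul_eq_one_right h5
  have hLan : AnalyticAt ℂ (fun z => ((2 * Real.pi * Complex.I) ^ n)⁻¹ * L (Φ z)) c :=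
    analyticAt_const.mul ((L.analyticAt _).fun_comp hΦ)
  refine hLan.congr ?_
  filter_upwards [Metric.ball_mem_nhds c hr] with z hz
  have hne : (2 * (Real.pi : ℂ) * Complex.I) ^ n ≠ 0 := by
    simp [Real.pi_ne_zero]
  have hmain := polydisc_cauchy hW hf hr hb hz
  rw [inv_mul_eq_iff_eq_mul₀ hne, ← hmain]
  change ∫ θ, Φ z θ * wt θ ∂μ = _
  unfold torusIntegral
  rw [← integral_subtype_comap measurableSet_Icc]
  refine integral_congr_ae (Eventually.of_forall fun θ => ?_)
  simp only [hΦval z hz θ, wt, ContinuousMap.coe_mk, smul_eq_mul]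
  ring


theorem runge_ball {n : ℕ} {h : (Fin n → ℂ) → ℂ} {W : Set (Fin n → ℂ)} (hW : IsOpen W)
    (hh : CHol h W) {r : ℝ} (hr : 0 < r) (hb : Metric.closedBall 0 r ⊆ W) {ε : ℝ} (hε : 0 < ε) :
    ∃ e : (Fin n → ℂ) → ℂ, CHol e univ ∧ ∀ z ∈ Metric.closedBall 0 r, ‖h z - e z‖ ≤ ε := by
  obtain ⟨δ, hδ, hδW⟩ := (isCompact_closedBall (0 : Fin n → ℂ) r).exists_cthickening_subset_open hW hb
  rw [cthickening_closedBall hδ.le hr.le] at hδW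
  obtain ⟨M, hM⟩ := (isCompact_closedBall (0 : Fin n → ℂ) (δ + r)).exists_bound_of_continuousOn
    (hh.continuousOn.mono (by simpa [add_comm] using hδW))
  have h0W : (0 : Fin n → ℂ) ∈ W := hb (by simp [hr.le])
  obtain ⟨p, hp⟩ := hh.analyticAt hW h0W
  set ρ : ℝ := (δ + r) / r with hρ
  have hρ1 : 1 < ρ := by rw [hρ, lt_div_iff₀ hr]; linarith
  have hρ0 : 0 < ρ := by linarith
  have hM0 : 0 ≤ M := (norm_nonneg _).trans (hM 0 (by simp; linarith))
  have key : ∀ z ∈ Metric.closedBall (0 : Fin n → ℂ) r,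
      HasSum (fun k => p k (fun _ => z)) (h z) ∧ ∀ k, ‖p k (fun _ => z)‖ ≤ M * (ρ⁻¹) ^ k := by
    intro z hz
    rw [mem_closedBall_zero_iff] at hz
    let ℓ : ℂ →L[ℂ] (Fin n → ℂ) := (ContinuousLinearMap.id ℂ ℂ).smulRight z
    have hℓ : ∀ x, ℓ x = x • z := fun x => by simp [ℓ]
    have hin : ∀ x ∈ Metric.closedBall (0 : ℂ) ρ, ℓ x ∈ Metric.closedBall (0 : Fin n → ℂ) (δ + r) := by
      intro x hx
      rw [mem_closedBall_zero_iff] at hx ⊢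
      rw [hℓ, norm_smul]
      calc ‖x‖ * ‖z‖ ≤ ρ * r := by gcongr
        _ = δ + r := by rw [hρ]; field_simp
    have hd : DifferentiableOn ℂ (h ∘ ℓ) (Metric.closedBall 0 ρ) := by
      intro x hx
      have hxW : ℓ x ∈ W := hδW (by simpa [add_comm] using hin x hx)
      exact ((hh.analyticAt hW hxW).differentiableAt.comp x
        ℓ.differentiableAt).differentiableWithinAt
    lift ρ to NNReal using hρ0.le with ρ'
    have hF := hd.hasFPowerSeriesOnBall (by exact_mod_cast hρ0)
    have hq : HasFPowerSeriesAt (h ∘ ℓ) (p.compContinuousLinearMap ℓ) 0 :=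
      HasFPowerSeriesAt.compContinuousLinearMap (by simpa using hp)
    have heq := hq.eq_formalMultilinearSeries hF.hasFPowerSeriesAt
    have hval : ∀ k, p k (fun _ => z) = cauchyPowerSeries (h ∘ ℓ) 0 ρ' k (fun _ => 1) := by
      intro k
      rw [← heq, FormalMultilinearSeries.compContinuousLinearMap_apply]
      congr 1
      funext i
      simp [hℓ]
    constructor
    · have := hF.hasSum (y := 1) (by
        simp only [Metric.mem_eball, edist_zero_right]
        rw [enorm_one]
        exact_mod_cast hρ1)
      simp only [zero_add, Function.comp, hℓ, one_smul] at this
      simpa only [hval] using this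
    · intro k
      rw [hval]
      refine ((cauchyPowerSeries (h ∘ ℓ) 0 ρ' k).le_opNorm _).trans ?_
      simp only [norm_one, Finset.prod_const_one, mul_one]
      refine (norm_cauchyPowerSeries_le _ _ _ _).trans ?_
      rw [abs_of_nonneg ρ'.coe_nonneg]
      gcongr
      have hIntg := intervalIntegral.norm_integral_le_of_norm_le_const (a := 0) (b := 2 * Real.pi)
        (f := fun θ => ‖(h ∘ ℓ) (circleMap 0 ρ' θ)‖) (C := M) (by
          intro θ _
          rw [norm_norm]
          exact hM _ (hin _ (circleMap_mem_closedBall _ ρ'.coe_nonneg _)))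
      have h2 := (le_abs_self _).trans hIntg
      rw [sub_zero, abs_of_pos Real.two_pi_pos] at h2
      calc _ ≤ (2 * Real.pi)⁻¹ * (M * (2 * Real.pi)) := by gcongr
        _ = M := by field_simp
  have hρi : ρ⁻¹ < 1 := inv_lt_one_of_one_lt₀ hρ1
  have hlim : Tendsto (fun N : ℕ => M * ρ⁻¹ ^ N / (1 - ρ⁻¹)) atTop (𝓝 (M * 0 / (1 - ρ⁻¹))) :=
    ((tendsto_pow_atTop_nhds_zero_of_lt_one (by positivity) hρi).const_mul M).div_const _
  rw [mul_zero, zero_div] at hlim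
  obtain ⟨N, hN⟩ := (hlim.eventually (gt_mem_nhds hε)).exists
  refine ⟨fun z => ∑ k ∈ Finset.range N, p k (fun _ => z), ?_, fun z hz => ?_⟩
  · refine CHol.sum _ fun k _ => ?_
    have hdiff : Differentiable ℂ (fun z : Fin n → ℂ => p k (fun _ => z)) := by
      have h1 : ContDiff ℂ 1 (p k) := (p k).contDiff
      have h2 : ContDiff ℂ 1 (fun z : Fin n → ℂ => p k (fun _ => z)) :=
        h1.comp (contDiff_pi.2 fun _ => contDiff_id)
      exact h2.differentiable one_ne_zero
    intro z _
    refine ⟨(hdiff z).continuousAt, fun j => ?_⟩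
    exact (hdiff _).comp (z j) ((hasFDerivAt_update z (z j)).differentiableAt)
  · obtain ⟨hs, hbd⟩ := key z hz
    have := dist_le_of_le_geometric_of_tendsto (ρ⁻¹) M hρi
      (f := fun N => ∑ k ∈ Finset.range N, p k (fun _ => z))
      (fun m => by
        rw [Finset.sum_range_succ, dist_comm, dist_eq_norm, add_sub_cancel_left]
        exact hbd m) hs.tendsto_sum_nat N
    rw [dist_comm, dist_eq_norm] at this
    exact this.trans hN.le


theorem seg_log (p c : ℂ) (a b : ℝ) (h : ∀ t ∈ uIcc a b, p + t * c ∈ Complex.slitPlane) :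
    ∫ t in a..b, c * (p + t * c)⁻¹ = Complex.log (p + b * c) - Complex.log (p + a * c) := by
  have hderiv : ∀ t : ℝ, HasDerivAt (fun t : ℝ => p + t * c) c t := by
    intro t
    have h1 : HasDerivAt (fun t : ℝ => (t : ℂ)) 1 t := Complex.ofRealCLM.hasDerivAt
    simpa using (h1.mul_const c).const_add p
  refine intervalIntegral.integral_eq_sub_of_hasDerivAt
    (f := fun t : ℝ => Complex.log (p + t * c)) (fun t ht => ?_) ?_
  · have := (hderiv t).clog_real (h t ht)
    rwa [div_eq_mul_inv] at this
  · refine ContinuousOn.intervalIntegrable ?_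
    refine continuousOn_const.mul (ContinuousOn.inv₀ (by fun_prop) fun t ht => ?_)
    exact Complex.slitPlane_ne_zero (h t ht)

theorem log_neg_im_pos {u : ℂ} (h : 0 < u.im) :
    Complex.log u - Complex.log (-u) = Real.pi * Complex.I := by
  simp only [Complex.log, norm_neg, Complex.arg_neg_eq_arg_sub_pi_of_im_pos h]
  push_cast
  ring

theorem rect_inv {x0 x1 y0 y1 : ℝ} {w : ℂ} (hw1 : x0 < w.re) (hw2 : w.re < x1)
    (hw3 : y0 < w.im) (hw4 : w.im < y1) :
    (∫ x in x0..x1, ((x + y0 * Complex.I : ℂ) - w)⁻¹) -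
      (∫ x in x0..x1, ((x + y1 * Complex.I : ℂ) - w)⁻¹) +
      Complex.I * (∫ y in y0..y1, ((x1 + y * Complex.I : ℂ) - w)⁻¹) -
      Complex.I * (∫ y in y0..y1, ((x0 + y * Complex.I : ℂ) - w)⁻¹) = 2 * Real.pi * Complex.I := by
  have hx : x0 < x1 := hw1.trans hw2
  have hy : y0 < y1 := hw3.trans hw4
  have e1 := seg_log (y0 * Complex.I - w) 1 x0 x1 (fun t _ => by
    rw [Complex.mem_slitPlane_iff]; right; simp; linarith)
  have e2 := seg_log (y1 * Complex.I - w) 1 x0 x1 (fun t _ => by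
    rw [Complex.mem_slitPlane_iff]; right; simp; linarith)
  have e3 := seg_log (x1 - w) Complex.I y0 y1 (fun t _ => by
    rw [Complex.mem_slitPlane_iff]; left; simp; linarith)
  have e4 := seg_log (w - x0) (-Complex.I) y0 y1 (fun t _ => by
    rw [Complex.mem_slitPlane_iff]; left; simp; linarith)
  have f1 : (∫ x in x0..x1, ((x + y0 * Complex.I : ℂ) - w)⁻¹) =
      ∫ x in x0..x1, (1 : ℂ) * ((y0 * Complex.I - w) + x * 1)⁻¹ := by
    congr 1; funext x; rw [one_mul]; congr 1; ring
  have f2 : (∫ x in x0..x1, ((x + y1 * Complex.I : ℂ) - w)⁻¹) =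
      ∫ x in x0..x1, (1 : ℂ) * ((y1 * Complex.I - w) + x * 1)⁻¹ := by
    congr 1; funext x; rw [one_mul]; congr 1; ring
  have f3 : Complex.I * (∫ y in y0..y1, ((x1 + y * Complex.I : ℂ) - w)⁻¹) =
      ∫ y in y0..y1, Complex.I * ((x1 - w) + y * Complex.I)⁻¹ := by
    rw [← intervalIntegral.integral_const_mul]
    congr 1; funext x; congr 2; ring
  have f4 : Complex.I * (∫ y in y0..y1, ((x0 + y * Complex.I : ℂ) - w)⁻¹) =
      ∫ y in y0..y1, -Complex.I * ((w - x0) + y * -Complex.I)⁻¹ := by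
    rw [← intervalIntegral.integral_const_mul]
    congr 1; funext x
    rw [show (w - x0 + x * -Complex.I : ℂ) = -((x0 + x * Complex.I : ℂ) - w) by ring, inv_neg]
    ring
  rw [f1, f2, f3, f4, e1, e2, e3, e4]
  have g1 := log_neg_im_pos (u := x0 + y1 * Complex.I - w) (by simp; linarith)
  have g2 := log_neg_im_pos (u := -(x0 + y0 * Complex.I - w)) (by simp; linarith)
  rw [neg_neg] at g2
  have s1 : (y0 * Complex.I - w + x1 * 1 : ℂ) = x1 - w + y0 * Complex.I := by ring
  have s2 : (y1 * Complex.I - w + x1 * 1 : ℂ) = x1 - w + y1 * Complex.I := by ring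
  have s3 : (y0 * Complex.I - w + x0 * 1 : ℂ) = x0 + y0 * Complex.I - w := by ring
  have s4 : (y1 * Complex.I - w + x0 * 1 : ℂ) = x0 + y1 * Complex.I - w := by ring
  have s5 : (w - x0 + y1 * -Complex.I : ℂ) = -(x0 + y1 * Complex.I - w) := by ring
  have s6 : (w - x0 + y0 * -Complex.I : ℂ) = -(x0 + y0 * Complex.I - w) := by ring
  rw [s1, s2, s3, s4, s5, s6]
  linear_combination g1 + g2

theorem rect_cauchy {x0 x1 y0 y1 : ℝ} {V : Set ℂ} (hV : IsOpen V)
    (hsub : Icc x0 x1 ×ℂ Icc y0 y1 ⊆ V) {F : ℂ → ℂ} (hF : DifferentiableOn ℂ F V)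
    {w : ℂ} (hw1 : x0 < w.re) (hw2 : w.re < x1)
    (hw3 : y0 < w.im) (hw4 : w.im < y1) :
    (∫ x in x0..x1, F (x + y0 * Complex.I) / ((x + y0 * Complex.I : ℂ) - w)) -
      (∫ x in x0..x1, F (x + y1 * Complex.I) / ((x + y1 * Complex.I : ℂ) - w)) +
      Complex.I * (∫ y in y0..y1, F (x1 + y * Complex.I) / ((x1 + y * Complex.I : ℂ) - w)) -
      Complex.I * (∫ y in y0..y1, F (x0 + y * Complex.I) / ((x0 + y * Complex.I : ℂ) - w))
      = 2 * Real.pi * Complex.I * F w := by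
  have hx : x0 < x1 := hw1.trans hw2
  have hy : y0 < y1 := hw3.trans hw4
  have hwV : w ∈ V := hsub (by
    rw [Complex.mem_reProdIm]; exact ⟨⟨hw1.le, hw2.le⟩, ⟨hw3.le, hw4.le⟩⟩)
  have hG : DifferentiableOn ℂ (dslope F w) V :=
    (Complex.differentiableOn_dslope (hV.mem_nhds hwV)).2 hF
  have h0 := Complex.integral_boundary_rect_eq_zero_of_differentiableOn (dslope F w)
    ⟨x0, y0⟩ ⟨x1, y1⟩ (by
      refine hG.mono ?_
      simpa [uIcc_of_le hx.le, uIcc_of_le hy.le] using hsub)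
  simp only [smul_eq_mul] at h0
  have hI := rect_inv hw1 hw2 hw3 hw4
  -- a general decomposition along a side
  have side : ∀ (γ : ℝ → ℂ) (a b : ℝ), Continuous γ → a ≤ b → (∀ t ∈ Icc a b, γ t ∈ V) →
      (∀ t, γ t ≠ w) →
      (∫ t in a..b, dslope F w (γ t)) =
        (∫ t in a..b, F (γ t) / (γ t - w)) - F w * ∫ t in a..b, (γ t - w)⁻¹ := by
    intro γ a b hγ hab hγV hne
    have hinv : Continuous (fun t => (γ t - w)⁻¹) :=
      (hγ.sub continuous_const).inv₀ fun t => sub_ne_zero.2 (hne t)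
    have hc : ContinuousOn (fun t => F (γ t)) (uIcc a b) :=
      hF.continuousOn.comp hγ.continuousOn (by rw [uIcc_of_le hab]; exact hγV)
    rw [← intervalIntegral.integral_const_mul, ← intervalIntegral.integral_sub]
    · congr 1
      funext t
      rw [dslope_of_ne _ (hne t), slope_def_field]
      rw [div_eq_mul_inv, div_eq_mul_inv]
      ring
    · simp only [div_eq_mul_inv]
      exact (hc.mul hinv.continuousOn).intervalIntegrable
    · exact (continuous_const.mul hinv).intervalIntegrable _ _
  have hmem : ∀ x ∈ Icc x0 x1, ∀ y ∈ Icc y0 y1, (x + y * Complex.I : ℂ) ∈ V := by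
    intro x hx y hy
    apply hsub
    rw [Complex.mem_reProdIm]
    simpa using ⟨hx, hy⟩
  have t1 := side (fun x => x + y0 * Complex.I) x0 x1 (by fun_prop) hx.le
    (fun t ht => hmem t ht _ ⟨le_rfl, hy.le⟩)
    (fun t h => by have := congrArg Complex.im h; simp at this; linarith)
  have t2 := side (fun x => x + y1 * Complex.I) x0 x1 (by fun_prop) hx.le
    (fun t ht => hmem t ht _ ⟨hy.le, le_rfl⟩)
    (fun t h => by have := congrArg Complex.im h; simp at this; linarith)
  have t3 := side (fun y => x1 + y * Complex.I) y0 y1 (by fun_prop) hy.le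
    (fun t ht => hmem _ ⟨hx.le, le_rfl⟩ t ht)
    (fun t h => by have := congrArg Complex.re h; simp at this; linarith)
  have t4 := side (fun y => x0 + y * Complex.I) y0 y1 (by fun_prop) hy.le
    (fun t ht => hmem _ ⟨le_rfl, hx.le⟩ t ht)
    (fun t h => by have := congrArg Complex.re h; simp at this; linarith)
  rw [t1, t2, t3, t4] at h0
  linear_combination h0 + F w * hI

/-- A pair of compact sets with a Cauchy-type splitting of functions near the intersection. -/
def CPair (B1 B2 : Set ℂ) : Prop :=
  ∀ V : Set ℂ, IsOpen V → B1 ∩ B2 ⊆ V →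
    ∃ (R : Set ℂ) (γ : Fin 4 → ℝ → ℂ) (α β : Fin 4 → ℝ) (c : Fin 4 → ℂ) (M : Finset (Fin 4)),
      IsOpen R ∧ B1 ∩ B2 ⊆ R ∧ R ⊆ V ∧ (∀ m, Continuous (γ m)) ∧
      (∀ m, ∀ t ∈ uIcc (α m) (β m), γ m t ∈ V ∧ γ m t ∉ R) ∧
      (∀ m ∈ M, ∀ t ∈ uIcc (α m) (β m), γ m t ∉ B1) ∧
      (∀ m ∉ M, ∀ t ∈ uIcc (α m) (β m), γ m t ∉ B2) ∧
      ∀ F : ℂ → ℂ, DifferentiableOn ℂ F V → ∀ w ∈ R,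
        ∑ m, c m * ∫ t in (α m)..(β m), F (γ m t) / (γ m t - w) = F w

theorem cpair_of_rect {B1 B2 V : Set ℂ} {x0 x1 y0 y1 : ℝ} (hV : IsOpen V)
    (hx : x0 < x1) (hy : y0 < y1)
    (hB : B1 ∩ B2 ⊆ Ioo x0 x1 ×ℂ Ioo y0 y1) (hsub : Icc x0 x1 ×ℂ Icc y0 y1 ⊆ V)
    (M : Finset (Fin 4))
    (s0 : ∀ t ∈ Icc x0 x1, (0 ∈ M → (t + y0 * Complex.I : ℂ) ∉ B1) ∧ (0 ∉ M → (t + y0 * Complex.I : ℂ) ∉ B2))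
    (s1 : ∀ t ∈ Icc x0 x1, (1 ∈ M → (t + y1 * Complex.I : ℂ) ∉ B1) ∧ (1 ∉ M → (t + y1 * Complex.I : ℂ) ∉ B2))
    (s2 : ∀ t ∈ Icc y0 y1, (2 ∈ M → (x1 + t * Complex.I : ℂ) ∉ B1) ∧ (2 ∉ M → (x1 + t * Complex.I : ℂ) ∉ B2))
    (s3 : ∀ t ∈ Icc y0 y1, (3 ∈ M → (x0 + t * Complex.I : ℂ) ∉ B1) ∧ (3 ∉ M → (x0 + t * Complex.I : ℂ) ∉ B2)) :
    ∃ (R : Set ℂ) (γ : Fin 4 → ℝ → ℂ) (α β : Fin 4 → ℝ) (c : Fin 4 → ℂ) (M : Finset (Fin 4)),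
      IsOpen R ∧ B1 ∩ B2 ⊆ R ∧ R ⊆ V ∧ (∀ m, Continuous (γ m)) ∧
      (∀ m, ∀ t ∈ uIcc (α m) (β m), γ m t ∈ V ∧ γ m t ∉ R) ∧
      (∀ m ∈ M, ∀ t ∈ uIcc (α m) (β m), γ m t ∉ B1) ∧
      (∀ m ∉ M, ∀ t ∈ uIcc (α m) (β m), γ m t ∉ B2) ∧
      ∀ F : ℂ → ℂ, DifferentiableOn ℂ F V → ∀ w ∈ R,
        ∑ m, c m * ∫ t in (α m)..(β m), F (γ m t) / (γ m t - w) = F w := by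
  have hmem : ∀ x ∈ Icc x0 x1, ∀ y ∈ Icc y0 y1, (x + y * Complex.I : ℂ) ∈ V := by
    intro x hx y hy
    apply hsub
    rw [Complex.mem_reProdIm]
    simpa using ⟨hx, hy⟩
  refine ⟨Ioo x0 x1 ×ℂ Ioo y0 y1, ![fun x => x + y0 * Complex.I, fun x => x + y1 * Complex.I,
    fun y => x1 + y * Complex.I, fun y => x0 + y * Complex.I], ![x0, x0, y0, y0], ![x1, x1, y1, y1],
    ![(2 * Real.pi * Complex.I)⁻¹, -(2 * Real.pi * Complex.I)⁻¹,
      (2 * Real.pi * Complex.I)⁻¹ * Complex.I, -((2 * Real.pi * Complex.I)⁻¹ * Complex.I)], M,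
    isOpen_Ioo.reProdIm isOpen_Ioo, hB, ?_, ?_, ?_, ?_, ?_, ?_⟩
  · refine subset_trans ?_ hsub
    exact Complex.reProdIm_subset_iff.2 (prod_mono Ioo_subset_Icc_self Ioo_subset_Icc_self)
  · intro m
    fin_cases m <;> simp <;> fun_prop
  · intro m
    fin_cases m
    · simp only [Fin.zero_eta, Matrix.cons_val_zero]
      intro t ht
      rw [uIcc_of_le hx.le] at ht
      refine ⟨hmem t ht y0 ⟨le_rfl, hy.le⟩, fun h => ?_⟩
      have := h.2
      simp at this
    · simp only [Fin.mk_one, Matrix.cons_val_one, Matrix.cons_val_zero]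
      intro t ht
      rw [uIcc_of_le hx.le] at ht
      refine ⟨hmem t ht y1 ⟨hy.le, le_rfl⟩, fun h => ?_⟩
      have := h.2
      simp at this
    · simp only [Fin.reduceFinMk, Matrix.cons_val]
      intro t ht
      rw [uIcc_of_le hy.le] at ht
      refine ⟨hmem x1 ⟨hx.le, le_rfl⟩ t ht, fun h => ?_⟩
      have := h.1
      simp at this
    · simp only [Fin.reduceFinMk, Matrix.cons_val]
      intro t ht
      rw [uIcc_of_le hy.le] at ht
      refine ⟨hmem x0 ⟨le_rfl, hx.le⟩ t ht, fun h => ?_⟩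
      have := h.1
      simp at this
  · intro m
    fin_cases m
    · simpa [uIcc_of_le hx.le] using fun hm t h1 h2 => (s0 t ⟨h1, h2⟩).1 hm
    · simpa [uIcc_of_le hx.le] using fun hm t h1 h2 => (s1 t ⟨h1, h2⟩).1 hm
    · simpa [uIcc_of_le hy.le] using fun hm t h1 h2 => (s2 t ⟨h1, h2⟩).1 hm
    · simpa [uIcc_of_le hy.le] using fun hm t h1 h2 => (s3 t ⟨h1, h2⟩).1 hm
  · intro m
    fin_cases m
    · simpa [uIcc_of_le hx.le] using fun hm t h1 h2 => (s0 t ⟨h1, h2⟩).2 hm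
    · simpa [uIcc_of_le hx.le] using fun hm t h1 h2 => (s1 t ⟨h1, h2⟩).2 hm
    · simpa [uIcc_of_le hy.le] using fun hm t h1 h2 => (s2 t ⟨h1, h2⟩).2 hm
    · simpa [uIcc_of_le hy.le] using fun hm t h1 h2 => (s3 t ⟨h1, h2⟩).2 hm
  · intro F hF w hw
    have hw1 := hw.1
    have hw2 := hw.2
    simp only [mem_preimage, mem_Ioo] at hw1 hw2
    have key := rect_cauchy hV hsub hF hw1.1 hw1.2 hw2.1 hw2.2
    have hne : (2 * (Real.pi : ℂ) * Complex.I) ≠ 0 := by simp [Real.pi_ne_zero]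
    rw [Fin.sum_univ_four]
    simp only [Matrix.cons_val_zero, Matrix.cons_val_one, Matrix.cons_val]
    have : F w = (2 * (Real.pi : ℂ) * Complex.I)⁻¹ * (2 * Real.pi * Complex.I * F w) := by
      rw [inv_mul_cancel_left₀ hne]
    rw [this, ← key]
    ring

/-- Room around a closed rectangle in an open set. -/
theorem rect_room {a b c d : ℝ} {V : Set ℂ} (hV : IsOpen V) (h : Icc a b ×ℂ Icc c d ⊆ V) :
    ∃ δ > 0, Icc (a - δ) (b + δ) ×ℂ Icc (c - δ) (d + δ) ⊆ V ∨ b < a ∨ d < c := by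
  by_cases hab : b < a
  · exact ⟨1, one_pos, Or.inr (Or.inl hab)⟩
  by_cases hcd : d < c
  · exact ⟨1, one_pos, Or.inr (Or.inr hcd)⟩
  push Not at hab hcd
  obtain ⟨δ, hδ, hsub⟩ := (isCompact_Icc.reProdIm isCompact_Icc).exists_cthickening_subset_open hV h
  refine ⟨δ / 2, by positivity, Or.inl ?_⟩
  intro z hz
  rw [Complex.mem_reProdIm] at hz
  apply hsub
  obtain ⟨⟨h1, h2⟩, h3, h4⟩ := hz
  have hx : ∀ {p q x : ℝ}, p ≤ q → p - δ / 2 ≤ x → x ≤ q + δ / 2 → ∃ y ∈ Icc p q, |x - y| ≤ δ / 2 := by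
    intro p q x hpq h1 h2
    rcases lt_or_ge x p with h | h
    · exact ⟨p, ⟨le_rfl, hpq⟩, by rw [abs_le]; constructor <;> linarith⟩
    · rcases lt_or_ge q x with h' | h'
      · exact ⟨q, ⟨hpq, le_rfl⟩, by rw [abs_le]; constructor <;> linarith⟩
      · exact ⟨x, ⟨h, h'⟩, by simp; positivity⟩
  obtain ⟨u, hu, hu'⟩ := hx hab h1 h2
  obtain ⟨v, hv, hv'⟩ := hx hcd h3 h4
  refine Metric.mem_cthickening_of_dist_le z ⟨u, v⟩ δ _ ?_ ?_
  · rw [Complex.mem_reProdIm]; exact ⟨hu, hv⟩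
  · rw [dist_eq_norm]
    refine (Complex.norm_le_abs_re_add_abs_im _).trans ?_
    simp only [Complex.sub_re, Complex.sub_im]
    linarith

theorem cpair_re {s t u c d : ℝ} (hst : s ≤ t) (htu : t ≤ u) (hcd : c ≤ d) :
    CPair (Icc s t ×ℂ Icc c d) (Icc t u ×ℂ Icc c d) := by
  intro V hV hsub
  have hIntg : (Icc s t ×ℂ Icc c d) ∩ (Icc t u ×ℂ Icc c d) = Icc t t ×ℂ Icc c d := by
    ext z
    simp only [mem_inter_iff, Complex.mem_reProdIm, mem_Icc]
    constructor
    · rintro ⟨⟨⟨_, h2⟩, h3⟩, ⟨⟨h4, _⟩, _⟩⟩; exact ⟨⟨h4, h2⟩, h3⟩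
    · rintro ⟨⟨h1, h2⟩, h3⟩
      exact ⟨⟨⟨by linarith, h2⟩, h3⟩, ⟨⟨h1, by linarith⟩, h3⟩⟩
  rw [hIntg] at hsub
  obtain ⟨δ, hδ, h | h | h⟩ := rect_room hV hsub
  · refine cpair_of_rect hV (x0 := t - δ) (x1 := t + δ) (y0 := c - δ) (y1 := d + δ)
      (by linarith) (by linarith) ?_ h {0, 1, 2} ?_ ?_ ?_ ?_
    · rw [hIntg]
      intro z hz
      simp only [Complex.mem_reProdIm, mem_Icc, mem_Ioo] at hz ⊢
      refine ⟨⟨?_, ?_⟩, ?_, ?_⟩ <;> linarith [hz.1.1, hz.1.2, hz.2.1, hz.2.2]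
    all_goals
      intro x hx
      simp only [Complex.mem_reProdIm]
      simp
    all_goals intros; linarith [hx.1, hx.2]
  · exact absurd h (lt_irrefl _)
  · linarith

theorem cpair_im {s t u a b : ℝ} (hst : s ≤ t) (htu : t ≤ u) (hab : a ≤ b) :
    CPair (Icc a b ×ℂ Icc s t) (Icc a b ×ℂ Icc t u) := by
  intro V hV hsub
  have hIntg : (Icc a b ×ℂ Icc s t) ∩ (Icc a b ×ℂ Icc t u) = Icc a b ×ℂ Icc t t := by
    ext z
    simp only [mem_inter_iff, Complex.mem_reProdIm, mem_Icc]
    constructor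
    · rintro ⟨⟨h3, ⟨_, h2⟩⟩, ⟨_, ⟨h4, _⟩⟩⟩; exact ⟨h3, ⟨h4, h2⟩⟩
    · rintro ⟨h3, ⟨h1, h2⟩⟩
      exact ⟨⟨h3, ⟨by linarith, h2⟩⟩, ⟨h3, ⟨h1, by linarith⟩⟩⟩
  rw [hIntg] at hsub
  obtain ⟨δ, hδ, h | h | h⟩ := rect_room hV hsub
  · refine cpair_of_rect hV (x0 := a - δ) (x1 := b + δ) (y0 := t - δ) (y1 := t + δ)
      (by linarith) (by linarith) ?_ h {1, 2, 3} ?_ ?_ ?_ ?_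
    · rw [hIntg]
      intro z hz
      simp only [Complex.mem_reProdIm, mem_Icc, mem_Ioo] at hz ⊢
      refine ⟨⟨?_, ?_⟩, ?_, ?_⟩ <;> linarith [hz.1.1, hz.1.2, hz.2.1, hz.2.2]
    all_goals
      intro x hx
      simp only [Complex.mem_reProdIm]
      simp
    all_goals intros; linarith [hx.1, hx.2]
  · linarith
  · exact absurd h (lt_irrefl _)


/-- The cylinder with `j`-th coordinate in `B` and the other coordinates in `A k`. -/
def Cyl {n : ℕ} (A : Fin n → Set ℂ) (j : Fin n) (B : Set ℂ) : Set (Fin n → ℂ) :=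
  {z | z j ∈ B ∧ ∀ k, k ≠ j → z k ∈ A k}

theorem Cyl.eq_pi {n : ℕ} (A : Fin n → Set ℂ) (j : Fin n) (B : Set ℂ) :
    Cyl A j B = Set.pi univ (Function.update A j B) := by
  ext z
  simp only [Cyl, mem_ofPred_eq, Set.mem_pi, mem_univ, true_imp_iff]
  constructor
  · rintro ⟨h1, h2⟩ k
    by_cases hk : k = j
    · subst hk; simpa using h1
    · simpa [hk] using h2 k hk
  · intro h
    refine ⟨by simpa using h j, fun k hk => by simpa [hk] using h k⟩

theorem Cyl.isCompact {n : ℕ} {A : Fin n → Set ℂ} (hA : ∀ k, IsCompact (A k)) (j : Fin n)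
    {B : Set ℂ} (hB : IsCompact B) : IsCompact (Cyl A j B) := by
  rw [Cyl.eq_pi]
  refine isCompact_univ_pi fun k => ?_
  by_cases hk : k = j
  · subst hk; simpa using hB
  · simpa [hk] using hA k

theorem Cyl.room {n : ℕ} {A : Fin n → Set ℂ} (hA : ∀ k, IsCompact (A k)) (j : Fin n)
    {B : Set ℂ} (hB : IsCompact B) {W : Set (Fin n → ℂ)} (hW : IsOpen W) (h : Cyl A j B ⊆ W) :
    ∃ δ > 0, Cyl (fun k => Metric.thickening δ (A k)) j (Metric.thickening δ B) ⊆ W := by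
  obtain ⟨δ, hδ, hsub⟩ := (Cyl.isCompact hA j hB).exists_thickening_subset_open hW h
  refine ⟨δ, hδ, ?_⟩
  rintro z ⟨h1, h2⟩
  apply hsub
  have hex : ∀ k, ∃ y, (k = j → y ∈ B) ∧ (k ≠ j → y ∈ A k) ∧ dist (z k) y < δ := by
    intro k
    by_cases hk : k = j
    · subst hk
      obtain ⟨y, hy, hd⟩ := Metric.mem_thickening_iff.1 h1
      exact ⟨y, fun _ => hy, fun h => absurd rfl h, hd⟩
    · obtain ⟨y, hy, hd⟩ := Metric.mem_thickening_iff.1 (h2 k hk)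
      exact ⟨y, fun h => absurd h hk, fun _ => hy, hd⟩
  choose y hy1 hy2 hy3 using hex
  refine Metric.mem_thickening_iff.2 ⟨y, ⟨hy1 j rfl, fun k hk => hy2 k hk⟩, ?_⟩
  rw [dist_pi_lt_iff hδ]
  exact hy3

theorem Cyl.mono {n : ℕ} {A A' : Fin n → Set ℂ} {j : Fin n} {B B' : Set ℂ}
    (hA : ∀ k, A k ⊆ A' k) (hB : B ⊆ B') : Cyl A j B ⊆ Cyl A' j B' :=
  fun _ hz => ⟨hB hz.1, fun k hk => hA k (hz.2 k hk)⟩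

theorem Cyl.isOpen {n : ℕ} {A : Fin n → Set ℂ} (hA : ∀ k, IsOpen (A k)) (j : Fin n)
    {B : Set ℂ} (hB : IsOpen B) : IsOpen (Cyl A j B) := by
  rw [Cyl.eq_pi]
  refine isOpen_set_pi finite_univ fun k _ => ?_
  by_cases hk : k = j
  · subst hk; simpa using hB
  · simpa [hk] using hA k

theorem split_lemma {n : ℕ} {A : Fin n → Set ℂ} (hA : ∀ k, IsCompact (A k)) (j : Fin n)
    {B1 B2 : Set ℂ} (hB1 : IsCompact B1) (hB2 : IsCompact B2) (hp : CPair B1 B2)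
    {W : Set (Fin n → ℂ)} (hW : IsOpen W) {h : (Fin n → ℂ) → ℂ} (hh : CHol h W)
    (hsub : Cyl A j (B1 ∩ B2) ⊆ W) :
    ∃ (O1 O2 O : Set (Fin n → ℂ)) (h1 h2 : (Fin n → ℂ) → ℂ), IsOpen O1 ∧ IsOpen O2 ∧ IsOpen O ∧
      Cyl A j B1 ⊆ O1 ∧ Cyl A j B2 ⊆ O2 ∧ Cyl A j (B1 ∩ B2) ⊆ O ∧ CHol h1 O1 ∧ CHol h2 O2 ∧
      ∀ z ∈ O, h z = h1 z - h2 z := by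
  obtain ⟨δ, hδ, hroom⟩ := Cyl.room hA j (hB1.inter hB2) hW hsub
  obtain ⟨R, γ, α, β, c, M, hR, hBR, hRV, hγ, hγV, hM1, hM2, hcau⟩ :=
    hp (Metric.thickening δ (B1 ∩ B2)) Metric.isOpen_thickening (Metric.self_subset_thickening hδ _)
  set A' : Fin n → Set ℂ := fun k => Metric.thickening δ (A k) with hA'
  have hA'o : ∀ k, IsOpen (A' k) := fun k => Metric.isOpen_thickening
  have hAA' : ∀ k, A k ⊆ A' k := fun k => Metric.self_subset_thickening hδ _
  let S : Fin 4 → Set ℂ := fun m => γ m '' uIcc (α m) (β m)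
  have hSc : ∀ m, IsClosed (S m) := fun m => (isCompact_uIcc.image (hγ m)).isClosed
  let T : Fin 4 → (Fin n → ℂ) → ℂ := fun m z =>
    c m * ∫ t in (α m)..(β m), h (Function.update z j (γ m t)) / (γ m t - z j)
  have hup : ∀ m, ∀ t ∈ uIcc (α m) (β m), ∀ (B : Set ℂ), ∀ z ∈ Cyl A' j B,
      Function.update z j (γ m t) ∈ W := by
    intro m t ht B z hz
    apply hroom
    refine ⟨by simpa using (hγV m t ht).1, fun k hk => by simpa [hk] using hz.2 k hk⟩
  have hT : ∀ m, CHol (T m) (Cyl A' j (S m)ᶜ) := by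
    intro m
    refine CHol.const_mul _ (CHol.param (Cyl.isOpen hA'o j (hSc m).isOpen_compl) ?_ ?_)
    · have hne : ∀ p ∈ Cyl A' j (S m)ᶜ ×ˢ uIcc (α m) (β m), γ m p.2 - p.1 j ≠ 0 := by
        rintro ⟨z, t⟩ ⟨hz, ht⟩ h0
        exact hz.1 ⟨t, ht, sub_eq_zero.1 h0⟩
      refine ContinuousOn.div ?_ ?_ hne
      · refine hh.continuousOn.comp
          (f := fun p : (Fin n → ℂ) × ℝ => Function.update p.1 j (γ m p.2)) ?_ ?_
        · have : Continuous (fun p : (Fin n → ℂ) × ℝ => Function.update p.1 j (γ m p.2)) :=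
            continuous_fst.update j ((hγ m).comp continuous_snd)
          exact this.continuousOn
        · rintro ⟨z, t⟩ ⟨hz, ht⟩
          exact hup m t ht _ z hz
      · exact (((hγ m).comp continuous_snd).sub
          ((continuous_apply j).comp continuous_fst)).continuousOn
    · intro t ht z hz
      have hzW := hup m t ht _ z hz
      have hne : γ m t - z j ≠ 0 := fun h0 => hz.1 ⟨t, ht, sub_eq_zero.1 h0⟩
      constructor
      · have hcu : Continuous (fun z : Fin n → ℂ => Function.update z j (γ m t)) :=
          continuous_id.update j continuous_const
        refine ContinuousAt.div ?_ ?_ hne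
        · exact ContinuousAt.comp (f := fun z : Fin n → ℂ => Function.update z j (γ m t))
            (hh _ hzW).1 hcu.continuousAt
        · exact (continuous_const.sub (continuous_apply j)).continuousAt
      · intro k
        by_cases hk : k = j
        · subst hk
          simp only [Function.update_idem, Function.update_self]
          exact (differentiableAt_const _).div
            ((differentiableAt_const _).sub differentiableAt_id) hne
        · have hk' : j ≠ k := fun h => hk h.symm
          simp only [Function.update_of_ne hk']
          refine DifferentiableAt.div_const ?_ _
          have := (hh _ hzW).2 k
          rw [Function.update_of_ne hk] at this
          have e : (fun w => h (Function.update (Function.update z k w) j (γ m t))) =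
              fun w => h (Function.update (Function.update z j (γ m t)) k w) := by
            funext w
            rw [Function.update_comm hk]
          rw [e]
          exact this
  refine ⟨Cyl A' j (⋂ m ∈ M, (S m)ᶜ), Cyl A' j (⋂ m ∈ Mᶜ, (S m)ᶜ), Cyl A' j R,
    fun z => ∑ m ∈ M, T m z, fun z => - ∑ m ∈ Mᶜ, T m z, ?_, ?_, ?_, ?_, ?_, ?_, ?_, ?_, ?_⟩
  · exact Cyl.isOpen hA'o j (isOpen_biInter_finset fun m _ => (hSc m).isOpen_compl)
  · exact Cyl.isOpen hA'o j (isOpen_biInter_finset fun m _ => (hSc m).isOpen_compl)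
  · exact Cyl.isOpen hA'o j hR
  · refine Cyl.mono hAA' fun w hw => ?_
    simp only [mem_iInter]
    rintro m hm ⟨t, ht, rfl⟩
    exact hM1 m hm t ht hw
  · refine Cyl.mono hAA' fun w hw => ?_
    simp only [mem_iInter]
    rintro m hm ⟨t, ht, rfl⟩
    exact hM2 m (Finset.mem_compl.1 hm) t ht hw
  · exact Cyl.mono hAA' hBR
  · exact CHol.sum _ fun m hm => (hT m).mono (Cyl.mono (fun _ => le_rfl) (biInter_subset_of_mem hm))
  · refine CHol.neg (CHol.sum _ fun m hm => (hT m).mono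
      (Cyl.mono (fun _ => le_rfl) ?_))
    exact biInter_subset_of_mem (s := {m | m ∈ Mᶜ}) (t := fun m => (S m)ᶜ) hm
  · intro z hz
    rw [sub_neg_eq_add, Finset.sum_add_sum_compl]
    have hd : DifferentiableOn ℂ (fun w => h (Function.update z j w)) (Metric.thickening δ (B1 ∩ B2)) := by
      refine hh.slice z j fun w hw => hroom ⟨by simpa using hw, fun k hk => ?_⟩
      simpa [hk] using hz.2 k hk
    have := hcau _ hd (z j) hz.1
    rw [Function.update_eq_self] at this
    exact this.symm

section
variable {n : ℕ} {ι : Type*}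

/-- The cocycle splits near `K`. -/
def Spl (U : ι → Set (Fin n → ℂ)) (f : ι → ι → (Fin n → ℂ) → ℂ) (K : Set (Fin n → ℂ)) : Prop :=
  ∃ W, IsOpen W ∧ K ⊆ W ∧ ∃ g : ι → (Fin n → ℂ) → ℂ, (∀ i, CHol (g i) (U i ∩ W)) ∧
    ∀ i j, ∀ z ∈ U i ∩ U j ∩ W, f i j z = g j z - g i z

variable {U : ι → Set (Fin n → ℂ)} {f : ι → ι → (Fin n → ℂ) → ℂ}

theorem Spl.mono {K K' : Set (Fin n → ℂ)} (h : Spl U f K) (hs : K' ⊆ K) : Spl U f K' := by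
  obtain ⟨W, hW, hK, g⟩ := h
  exact ⟨W, hW, hs.trans hK, g⟩

/-- Two solutions differ by a global holomorphic function. -/
theorem diff_global (hUopen : ∀ i, IsOpen (U i)) (hUcover : (⋃ i, U i) = Set.univ)
    {W1 W2 : Set (Fin n → ℂ)} (hW1 : IsOpen W1) (hW2 : IsOpen W2)
    {g1 g2 : ι → (Fin n → ℂ) → ℂ} (h1 : ∀ i, CHol (g1 i) (U i ∩ W1))
    (h2 : ∀ i, CHol (g2 i) (U i ∩ W2))
    (e1 : ∀ i j, ∀ z ∈ U i ∩ U j ∩ W1, f i j z = g1 j z - g1 i z)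
    (e2 : ∀ i j, ∀ z ∈ U i ∩ U j ∩ W2, f i j z = g2 j z - g2 i z) :
    ∃ h : (Fin n → ℂ) → ℂ, CHol h (W1 ∩ W2) ∧
      ∀ i, ∀ z ∈ U i ∩ (W1 ∩ W2), h z = g1 i z - g2 i z := by
  have hex : ∀ z, ∃ i, z ∈ U i := fun z => mem_iUnion.1 (hUcover ▸ mem_univ z)
  choose ix hix using hex
  have key : ∀ i, ∀ z ∈ U i ∩ (W1 ∩ W2), g1 (ix z) z - g2 (ix z) z = g1 i z - g2 i z := by
    rintro i z ⟨hz, hz1, hz2⟩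
    have a1 := e1 i (ix z) z ⟨⟨hz, hix z⟩, hz1⟩
    have a2 := e2 i (ix z) z ⟨⟨hz, hix z⟩, hz2⟩
    linear_combination a2 - a1
  refine ⟨fun z => g1 (ix z) z - g2 (ix z) z, ?_, key⟩
  intro z hz
  have hO : IsOpen (U (ix z) ∩ (W1 ∩ W2)) := (hUopen _).inter (hW1.inter hW2)
  have hc : CHol (fun y => g1 (ix z) y - g2 (ix z) y) (U (ix z) ∩ (W1 ∩ W2)) :=
    ((h1 _).mono fun y hy => ⟨hy.1, hy.2.1⟩).sub ((h2 _).mono fun y hy => ⟨hy.1, hy.2.2⟩)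
  exact (hc.congr hO fun y hy => (key _ y hy).symm) z ⟨hix z, hz⟩

theorem spl_merge (hUopen : ∀ i, IsOpen (U i)) (hUcover : (⋃ i, U i) = Set.univ)
    {A : Fin n → Set ℂ} (hA : ∀ k, IsCompact (A k)) (j : Fin n)
    {B1 B2 : Set ℂ} (hB1 : IsCompact B1) (hB2 : IsCompact B2) (hp : CPair B1 B2)
    (s1 : Spl U f (Cyl A j B1)) (s2 : Spl U f (Cyl A j B2)) :
    Spl U f (Cyl A j (B1 ∪ B2)) := by
  classical
  obtain ⟨W1, hW1, hK1, g1, hg1, e1⟩ := s1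
  obtain ⟨W2, hW2, hK2, g2, hg2, e2⟩ := s2
  obtain ⟨h, hh, hhe⟩ := diff_global hUopen hUcover hW1 hW2 hg1 hg2 e1 e2
  obtain ⟨O1, O2, O, h1, h2, hO1, hO2, hO, hKO1, hKO2, hKO, hh1, hh2, hsp⟩ :=
    split_lemma hA j hB1 hB2 hp (hW1.inter hW2) hh
      (fun z hz => ⟨hK1 ⟨hz.1.1, hz.2⟩, hK2 ⟨hz.1.2, hz.2⟩⟩)
  have hc1 := Cyl.isCompact hA j hB1
  have hc2 := Cyl.isCompact hA j hB2
  have hdisj : Disjoint (Cyl A j B1 \ O) (Cyl A j B2) := by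
    rw [Set.disjoint_left]
    rintro z ⟨hz1, hz2⟩ hz3
    exact hz2 (hKO ⟨⟨hz1.1, hz3.1⟩, hz1.2⟩)
  obtain ⟨X, Y, hX, hY, hKX, hKY, hXY⟩ :=
    SeparatedNhds.of_isCompact_isCompact (hc1.diff hO) hc2 hdisj
  let W1' := (X ∪ O) ∩ (O1 ∩ W1)
  let W2' := Y ∩ (O2 ∩ W2)
  have hW1' : IsOpen W1' := (hX.union hO).inter (hO1.inter hW1)
  have hW2' : IsOpen W2' := hY.inter (hO2.inter hW2)
  have hWW : ∀ z ∈ W1', z ∈ W2' → z ∈ O := by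
    rintro z ⟨hz | hz, _⟩ ⟨hz2, _⟩
    · exact absurd hz2 (Set.disjoint_left.1 hXY hz)
    · exact hz
  let g : ι → (Fin n → ℂ) → ℂ := fun i z => if z ∈ W1' then g1 i z - h1 z else g2 i z - h2 z
  have gv1 : ∀ i, ∀ z ∈ W1', g i z = g1 i z - h1 z := fun i z hz => if_pos hz
  have gv2 : ∀ i, ∀ z ∈ U i ∩ W2', g i z = g2 i z - h2 z := by
    rintro i z ⟨hzU, hz⟩
    by_cases hz1 : z ∈ W1'
    · rw [gv1 i z hz1]
      have a1 := hsp z (hWW z hz1 hz)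
      have a2 := hhe i z ⟨hzU, hz1.2.2, hz.2.2⟩
      linear_combination a1 - a2
    · exact if_neg hz1
  refine ⟨W1' ∪ W2', hW1'.union hW2', ?_, g, ?_, ?_⟩
  · rintro z ⟨hz | hz, hz'⟩
    · left
      refine ⟨?_, hKO1 ⟨hz, hz'⟩, hK1 ⟨hz, hz'⟩⟩
      by_cases hzO : z ∈ O
      · exact Or.inr hzO
      · exact Or.inl (hKX ⟨⟨hz, hz'⟩, hzO⟩)
    · right
      exact ⟨hKY ⟨hz, hz'⟩, hKO2 ⟨hz, hz'⟩, hK2 ⟨hz, hz'⟩⟩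
  · intro i
    rw [inter_union_distrib_left]
    refine CHol.union ?_ ?_
    · refine CHol.congr (f := fun z => g1 i z - h1 z) ((hUopen i).inter hW1') ?_
        fun z hz => (gv1 i z hz.2).symm
      exact ((hg1 i).mono fun z hz => ⟨hz.1, hz.2.2.2⟩).sub (hh1.mono fun z hz => hz.2.2.1)
    · refine CHol.congr (f := fun z => g2 i z - h2 z) ((hUopen i).inter hW2') ?_
        fun z hz => (gv2 i z hz).symm
      exact ((hg2 i).mono fun z hz => ⟨hz.1, hz.2.2.2⟩).sub (hh2.mono fun z hz => hz.2.2.1)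
  · rintro i k z ⟨⟨hzi, hzk⟩, hz | hz⟩
    · rw [gv1 i z hz, gv1 k z hz, e1 i k z ⟨⟨hzi, hzk⟩, hz.2.2⟩]
      ring
    · rw [gv2 i z ⟨hzi, hz⟩, gv2 k z ⟨hzk, hz⟩, e2 i k z ⟨⟨hzi, hzk⟩, hz.2.2⟩]
      ring

theorem spl_interval (hUopen : ∀ i, IsOpen (U i)) (hUcover : (⋃ i, U i) = Set.univ)
    {A : Fin n → Set ℂ} (hA : ∀ k, IsCompact (A k)) (j : Fin n)
    {a b : ℝ} (hab : a ≤ b) (B : ℝ → ℝ → Set ℂ) (hB : ∀ s t, IsCompact (B s t))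
    (hpair : ∀ s t u, s ≤ t → t ≤ u → CPair (B s t) (B t u))
    (hun : ∀ s t u, s ≤ t → t ≤ u → B s t ∪ B t u = B s u)
    (hloc : ∀ t, ∀ δ > 0, ∃ ε > 0, ∀ s u, t - ε < s → u < t + ε → B s u ⊆ Metric.thickening δ (B t t))
    (hpt : ∀ t ∈ Icc a b, Spl U f (Cyl A j (B t t))) : Spl U f (Cyl A j (B a b)) := by
  have hnear : ∀ t : Icc a b, ∃ ε > 0, ∀ s u, t.1 - ε < s → u < t.1 + ε →
      Spl U f (Cyl A j (B s u)) := by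
    intro t
    obtain ⟨W, hW, hK, hg⟩ := hpt t.1 t.2
    obtain ⟨δ, hδ, hroom⟩ := Cyl.room hA j (hB _ _) hW hK
    obtain ⟨ε, hε, hsub⟩ := hloc t.1 δ hδ
    refine ⟨ε, hε, fun s u hs hu => ⟨W, hW, ?_, hg⟩⟩
    exact (Cyl.mono (fun k => Metric.self_subset_thickening hδ _) (hsub s u hs hu)).trans hroom
  choose ε hε hS using hnear
  obtain ⟨t, ht0, htm, ⟨N, hN⟩, hcov⟩ := exists_monotone_Icc_subset_open_cover_Icc hab
    (c := fun t : Icc a b => Metric.ball t (ε t)) (fun t => Metric.isOpen_ball)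
    (fun t _ => mem_iUnion.2 ⟨t, Metric.mem_ball_self (hε t)⟩)
  have hind : ∀ m, Spl U f (Cyl A j (B a (t m))) := by
    intro m
    induction m with
    | zero => rw [ht0]; exact hpt a ⟨le_rfl, hab⟩
    | succ m ih =>
      have hle : t m ≤ t (m + 1) := htm (Nat.le_succ m)
      obtain ⟨i, hi⟩ := hcov m
      have m1 := hi (left_mem_Icc.2 hle)
      have m2 := hi (right_mem_Icc.2 hle)
      rw [Metric.mem_ball, Subtype.dist_eq, Real.dist_eq, abs_lt] at m1 m2
      have := hS i (t m) (t (m + 1)) (by linarith [m1.1]) (by linarith [m2.2])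
      have hm := spl_merge hUopen hUcover hA j (hB _ _) (hB _ _)
        (hpair a (t m) (t (m + 1)) (t m).2.1 hle) ih this
      rwa [hun a (t m) (t (m + 1)) (t m).2.1 hle] at hm
  have := hind N
  rwa [hN N le_rfl] at this

theorem spl_point (hUcover : (⋃ i, U i) = Set.univ) (hUopen : ∀ i, IsOpen (U i))
    (hf : ∀ i j, CHol (f i j) (U i ∩ U j))
    (hcocycle : ∀ i j k, ∀ z ∈ U i ∩ U j ∩ U k, f i j z + f j k z = f i k z)
    (x : Fin n → ℂ) : Spl U f {x} := by
  obtain ⟨i, hi⟩ := mem_iUnion.1 (hUcover ▸ mem_univ x : x ∈ ⋃ i, U i)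
  refine ⟨U i, hUopen i, by simpa using hi, fun k => f i k, fun k => (hf i k).mono ?_, ?_⟩
  · exact fun z hz => ⟨hz.2, hz.1⟩
  · rintro k l z ⟨⟨hk, hl⟩, hz⟩
    have := hcocycle i k l z ⟨⟨hz, hk⟩, hl⟩
    linear_combination this

theorem spl_box (hUopen : ∀ i, IsOpen (U i)) (hUcover : (⋃ i, U i) = Set.univ)
    (hf : ∀ i j, CHol (f i j) (U i ∩ U j))
    (hcocycle : ∀ i j k, ∀ z ∈ U i ∩ U j ∩ U k, f i j z + f j k z = f i k z)
    {a b : ℝ} (hab : a ≤ b) (S : Finset (Fin n)) : ∀ A : Fin n → Set ℂ,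
      (∀ k ∈ S, A k = Icc a b ×ℂ Icc a b) → (∀ k ∉ S, ∃ x, A k = {x}) →
      Spl U f (Set.pi univ A) := by
  classical
  induction S using Finset.induction_on with
  | empty =>
    intro A _ hA
    choose x hx using fun k => hA k (Finset.notMem_empty k)
    refine (spl_point hUcover hUopen hf hcocycle x).mono ?_
    intro z hz
    rw [mem_singleton_iff]
    funext k
    have := hz k (mem_univ k)
    rwa [hx k] at this
  | insert j S hj ih =>
    intro A hA1 hA2
    have hAc : ∀ k, IsCompact (A k) := by
      intro k
      by_cases hk : k ∈ insert j S
      · rw [hA1 k hk]; exact isCompact_Icc.reProdIm isCompact_Icc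
      · obtain ⟨x, hx⟩ := hA2 k hk
        rw [hx]; exact isCompact_singleton
    have hpi : Set.pi univ A = Cyl A j (Icc a b ×ℂ Icc a b) := by
      rw [Cyl.eq_pi, ← hA1 j (Finset.mem_insert_self j S), Function.update_eq_self]
    rw [hpi]
    have clamp : ∀ (t δ : ℝ), 0 < δ → ∀ s u, t - δ / 2 < s → u < t + δ / 2 → ∀ x ∈ Icc s u,
        |x - t| < δ := by
      intro t δ hδ s u hs hu x hx
      rw [abs_lt]
      constructor <;> linarith [hx.1, hx.2]
    refine spl_interval hUopen hUcover hAc j hab (fun s t => Icc a b ×ℂ Icc s t)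
      (fun s t => isCompact_Icc.reProdIm isCompact_Icc)
      (fun s t u hst htu => cpair_im hst htu hab) ?_ ?_ ?_
    · intro s t u hst htu
      ext z
      simp only [mem_union, Complex.mem_reProdIm, ← and_or_left, ← Icc_union_Icc_eq_Icc hst htu]
    · intro t δ hδ
      refine ⟨δ / 2, by positivity, fun s u hs hu z hz => ?_⟩
      rw [Complex.mem_reProdIm] at hz
      refine Metric.mem_thickening_iff.2 ⟨⟨z.re, t⟩, ?_, ?_⟩
      · rw [Complex.mem_reProdIm]; exact ⟨hz.1, by simp⟩
      · rw [dist_eq_norm]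
        refine (Complex.norm_le_abs_re_add_abs_im _).trans_lt ?_
        simpa using clamp t δ hδ s u hs hu _ hz.2
    intro y hy
    refine spl_interval hUopen hUcover hAc j hab (fun s t => Icc s t ×ℂ Icc y y)
      (fun s t => isCompact_Icc.reProdIm isCompact_Icc)
      (fun s t u hst htu => cpair_re hst htu le_rfl) ?_ ?_ ?_
    · intro s t u hst htu
      ext z
      simp only [mem_union, Complex.mem_reProdIm, ← or_and_right, ← Icc_union_Icc_eq_Icc hst htu]
    · intro t δ hδ
      refine ⟨δ / 2, by positivity, fun s u hs hu z hz => ?_⟩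
      rw [Complex.mem_reProdIm] at hz
      refine Metric.mem_thickening_iff.2 ⟨⟨t, z.im⟩, ?_, ?_⟩
      · rw [Complex.mem_reProdIm]; exact ⟨by simp, hz.2⟩
      · rw [dist_eq_norm]
        refine (Complex.norm_le_abs_re_add_abs_im _).trans_lt ?_
        simpa using clamp t δ hδ s u hs hu _ hz.1
    intro x hx
    rw [Cyl.eq_pi]
    refine ih _ ?_ ?_
    · intro k hk
      have hkj : k ≠ j := fun h => hj (h ▸ hk)
      rw [Function.update_of_ne hkj]
      exact hA1 k (Finset.mem_insert_of_mem hk)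
    · intro k hk
      by_cases hkj : k = j
      · subst hkj
        refine ⟨⟨x, y⟩, ?_⟩
        rw [Function.update_self]
        ext z
        simp [Complex.mem_reProdIm, Complex.ext_iff]
      · rw [Function.update_of_ne hkj]
        exact hA2 k (by simp [hkj, hk])

theorem spl_ball (hUopen : ∀ i, IsOpen (U i)) (hUcover : (⋃ i, U i) = Set.univ)
    (hf : ∀ i j, CHol (f i j) (U i ∩ U j))
    (hcocycle : ∀ i j k, ∀ z ∈ U i ∩ U j ∩ U k, f i j z + f j k z = f i k z)
    {r : ℝ} (hr : 0 ≤ r) : Spl U f (Metric.closedBall 0 r) := by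
  refine (spl_box hUopen hUcover hf hcocycle (a := -r) (b := r) (by linarith) Finset.univ
    (fun _ => Icc (-r) r ×ℂ Icc (-r) r) (fun _ _ => rfl) (fun k hk => absurd (Finset.mem_univ k) hk)).mono ?_
  intro z hz k _
  rw [mem_closedBall_zero_iff] at hz
  have hk := (norm_le_pi_norm z k).trans hz
  rw [Complex.mem_reProdIm]
  exact ⟨abs_le.1 ((Complex.abs_re_le_norm _).trans hk), abs_le.1 ((Complex.abs_im_le_norm _).trans hk)⟩
end


theorem CHol.of_uniform {n : ℕ} {W : Set (Fin n → ℂ)} (hW : IsOpen W)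
    {F : ℕ → (Fin n → ℂ) → ℂ} {G : (Fin n → ℂ) → ℂ} {m : ℕ}
    (hF : ∀ N, m ≤ N → CHol (F N) W) (hu : TendstoUniformlyOn F G atTop W) : CHol G W := by
  have hev : ∀ᶠ N in atTop, CHol (F N) W := (eventually_ge_atTop m).mono hF
  intro z hz
  constructor
  · have := hu.continuousOn (hev.mono fun N h => h.continuousOn).frequently
    exact this.continuousAt (hW.mem_nhds hz)
  · intro j
    let V : Set ℂ := {w | Function.update z j w ∈ W}
    have hV : IsOpen V := CHol.isOpen_slice hW z j
    have hu' : TendstoUniformlyOn (fun N w => F N (Function.update z j w))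
        (fun w => G (Function.update z j w)) atTop V := by
      have := hu.comp (fun w : ℂ => Function.update z j w)
      exact this
    have hd : DifferentiableOn ℂ (fun w => G (Function.update z j w)) V :=
      hu'.tendstoLocallyUniformlyOn.differentiableOn
        (hev.mono fun N h => h.slice z j (fun w hw => hw)) hV
    refine hd.differentiableAt (hV.mem_nhds ?_)
    show Function.update z j (z j) ∈ W
    rwa [Function.update_eq_self]

theorem cousin_one_aux {n : ℕ} {ι : Type*} (U : ι → Set (Fin n → ℂ))
    (hUopen : ∀ i, IsOpen (U i)) (hUcover : (⋃ i, U i) = Set.univ)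
    (f : ι → ι → (Fin n → ℂ) → ℂ)
    (hf : ∀ i j, AnalyticOn ℂ (f i j) (U i ∩ U j))
    (hcocycle : ∀ i j k, ∀ z ∈ U i ∩ U j ∩ U k, f i j z + f j k z = f i k z) :
    ∃ g : ι → (Fin n → ℂ) → ℂ,
      (∀ i, AnalyticOn ℂ (g i) (U i)) ∧
      ∀ i j, ∀ z ∈ U i ∩ U j, f i j z = g j z - g i z := by
  have hfC : ∀ i j, CHol (f i j) (U i ∩ U j) := fun i j =>
    CHol.of_analyticOn ((hUopen i).inter (hUopen j)) (hf i j)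
  have hS : ∀ m : ℕ, Spl U f (Metric.closedBall 0 ((m : ℝ) + 1)) := fun m =>
    spl_ball hUopen hUcover hfC hcocycle (by positivity)
  choose W hW hK g hg eg using hS
  have hD : ∀ m : ℕ, ∃ e : (Fin n → ℂ) → ℂ, CHol e univ ∧
      ∀ i, ∀ z ∈ U i ∩ Metric.closedBall 0 ((m : ℝ) + 1),
        ‖g (m + 1) i z - g m i z - e z‖ ≤ 1 * (1 / 2 : ℝ) ^ m := by
    intro m
    obtain ⟨h, hh, he⟩ := diff_global hUopen hUcover (hW (m + 1)) (hW m) (hg (m + 1)) (hg m)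
      (eg (m + 1)) (eg m)
    have hsub : Metric.closedBall (0 : Fin n → ℂ) ((m : ℝ) + 1) ⊆ W (m + 1) ∩ W m := by
      refine subset_inter (Subset.trans (Metric.closedBall_subset_closedBall ?_) (hK (m + 1))) (hK m)
      push_cast
      linarith
    obtain ⟨e, hec, hee⟩ := runge_ball ((hW (m + 1)).inter (hW m)) hh
      (by positivity : (0 : ℝ) < (m : ℝ) + 1) hsub (by positivity : (0 : ℝ) < 1 * (1 / 2 : ℝ) ^ m)
    refine ⟨e, hec, fun i z hz => ?_⟩
    rw [← he i z ⟨hz.1, hsub hz.2⟩]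
    exact hee z hz.2
  choose e hec hee using hD
  let s : ℕ → ι → (Fin n → ℂ) → ℂ := fun N i z => g N i z - ∑ l ∈ Finset.range N, e l z
  have hstep : ∀ (m N : ℕ), m ≤ N → ∀ i, ∀ z ∈ U i ∩ Metric.closedBall 0 ((m : ℝ) + 1),
      dist (s N i z) (s (N + 1) i z) ≤ 1 * (1 / 2 : ℝ) ^ N := by
    intro m N hmN i z hz
    have hmN' : (m : ℝ) ≤ N := by exact_mod_cast hmN
    have := hee N i z ⟨hz.1, Metric.closedBall_subset_closedBall (by linarith) hz.2⟩
    rw [dist_comm, dist_eq_norm]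
    have hE : s (N + 1) i z - s N i z = g (N + 1) i z - g N i z - e N z := by
      simp only [s, Finset.sum_range_succ]
      ring
    rw [hE]
    exact this
  have hball : ∀ z : Fin n → ℂ, ∃ m : ℕ, z ∈ Metric.ball (0 : Fin n → ℂ) ((m : ℝ) + 1) := by
    intro z
    obtain ⟨m, hm⟩ := exists_nat_gt ‖z‖
    exact ⟨m, by rw [mem_ball_zero_iff]; linarith⟩
  have hlim : ∀ i z, ∃ G : ℂ, z ∈ U i → Tendsto (fun N => s N i z) atTop (𝓝 G) := by
    intro i z
    by_cases hz : z ∈ U i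
    · obtain ⟨m, hm⟩ := hball z
      have hc : CauchySeq (fun N => s (N + m) i z) := by
        refine cauchySeq_of_le_geometric (1 / 2 : ℝ) ((1 / 2 : ℝ) ^ m) (by norm_num) fun N => ?_
        have := hstep m (N + m) (by omega) i z ⟨hz, Metric.ball_subset_closedBall hm⟩
        rw [add_right_comm N 1 m]
        refine this.trans (le_of_eq ?_)
        rw [pow_add]
        ring
      obtain ⟨G, hG⟩ := cauchySeq_tendsto_of_complete hc
      exact ⟨G, fun _ => (tendsto_add_atTop_iff_nat m).1 hG⟩
    · exact ⟨0, fun h => absurd h hz⟩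
  choose G hG using hlim
  have hbound : ∀ (m N : ℕ), m ≤ N → ∀ i, ∀ z ∈ U i ∩ Metric.closedBall 0 ((m : ℝ) + 1),
      dist (s N i z) (G i z) ≤ 2 * (1 / 2 : ℝ) ^ N := by
    intro m N hmN i z hz
    have ht : Tendsto (fun k => s (k + N) i z) atTop (𝓝 (G i z)) :=
      (tendsto_add_atTop_iff_nat N).2 (hG i z hz.1)
    have := dist_le_of_le_geometric_of_tendsto₀ (1 / 2 : ℝ) ((1 / 2 : ℝ) ^ N) (by norm_num)
      (f := fun k => s (k + N) i z) (fun k => by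
        have := hstep m (k + N) (by omega) i z hz
        rw [add_right_comm k 1 N]
        refine this.trans (le_of_eq ?_)
        rw [pow_add]
        ring) ht
    simp only [zero_add] at this
    refine this.trans (le_of_eq ?_)
    ring
  have hsC : ∀ m N : ℕ, m ≤ N → ∀ i, CHol (s N i) (U i ∩ Metric.ball 0 ((m : ℝ) + 1)) := by
    intro m N hmN i
    have hmN' : (m : ℝ) ≤ N := by exact_mod_cast hmN
    refine CHol.sub ((hg N i).mono ?_) (CHol.sum _ fun l _ => (hec l).mono (subset_univ _))
    refine inter_subset_inter_right _ (Subset.trans ?_ (hK N))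
    exact Metric.ball_subset_closedBall.trans (Metric.closedBall_subset_closedBall (by linarith))
  refine ⟨G, fun i z hz => ?_, ?_⟩
  · obtain ⟨m, hm⟩ := hball z
    have hO : IsOpen (U i ∩ Metric.ball (0 : Fin n → ℂ) ((m : ℝ) + 1)) :=
      (hUopen i).inter Metric.isOpen_ball
    have hu : TendstoUniformlyOn (fun N => s N i) (G i) atTop
        (U i ∩ Metric.ball (0 : Fin n → ℂ) ((m : ℝ) + 1)) := by
      rw [Metric.tendstoUniformlyOn_iff]
      intro ε hε
      have h0 : Tendsto (fun N : ℕ => 2 * (1 / 2 : ℝ) ^ N) atTop (𝓝 0) := by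
        have := (tendsto_pow_atTop_nhds_zero_of_lt_one (r := (1 / 2 : ℝ)) (by norm_num)
          (by norm_num)).const_mul 2
        simpa using this
      filter_upwards [h0.eventually (gt_mem_nhds hε), eventually_ge_atTop m] with N hN hmN x hx
      rw [dist_comm]
      exact (hbound m N hmN i x ⟨hx.1, Metric.ball_subset_closedBall hx.2⟩).trans_lt hN
    have hc : CHol (G i) (U i ∩ Metric.ball (0 : Fin n → ℂ) ((m : ℝ) + 1)) :=
      CHol.of_uniform hO (fun N hN => hsC m N hN i) hu
    exact (hc.analyticAt hO ⟨hz, hm⟩).analyticWithinAt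
  · intro i j z hz
    obtain ⟨m, hm⟩ := hball z
    have h1 : Tendsto (fun N => s N j z - s N i z) atTop (𝓝 (G j z - G i z)) :=
      (hG j z hz.2).sub (hG i z hz.1)
    refine tendsto_nhds_unique (tendsto_const_nhds.congr' ?_) h1
    filter_upwards [eventually_ge_atTop m] with N hmN
    have hmN' : (m : ℝ) ≤ N := by exact_mod_cast hmN
    have hzW : z ∈ W N := hK N (Metric.closedBall_subset_closedBall (by linarith)
      (Metric.ball_subset_closedBall hm))
    rw [eg N i j z ⟨hz, hzW⟩]
    simp only [s]
    ring


end CousinHelpers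

/-- **Solvability of the additive Cousin problem (Cousin I) on `ℂⁿ`.**
Given an open cover `(Uᵢ)` of `ℂⁿ` and a Čech 1-cocycle `(f i j)` of holomorphic
functions (`f i j` holomorphic on `Uᵢ ∩ Uⱼ`, antisymmetric, and satisfying the
cocycle condition on triple intersections), there are functions `g i` holomorphic
on `Uᵢ` with `f i j = g j - g i` on `Uᵢ ∩ Uⱼ`. -/
theorem cousin_one {n : ℕ} {ι : Type*} (U : ι → Set (Fin n → ℂ))
    (hUopen : ∀ i, IsOpen (U i)) (hUcover : (⋃ i, U i) = Set.univ)
    (f : ι → ι → (Fin n → ℂ) → ℂ)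
    (hf : ∀ i j, AnalyticOn ℂ (f i j) (U i ∩ U j))
    (hanti : ∀ i j, ∀ z ∈ U i ∩ U j, f i j z = -f j i z)
    (hcocycle : ∀ i j k, ∀ z ∈ U i ∩ U j ∩ U k, f i j z + f j k z = f i k z) :
    ∃ g : ι → (Fin n → ℂ) → ℂ,
      (∀ i, AnalyticOn ℂ (g i) (U i)) ∧
      ∀ i j, ∀ z ∈ U i ∩ U j, f i j z = g j z - g i z := by
  exact cousin_one_aux U hUopen hUcover f hf hcocycle
end
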